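/- arXiv:1707.07488 — 6 statements merged into one kernel-verified Lean document; each statement's English description precedes it below -/
import Mathlib

section
/- Fix a real slope s > 1 and suppose that for some γ ∈ ℝ the map Q_γ satisfies the matching condition with some matching exponents κ⁻, κ⁺ ≥ 1. Then s is an algebraic integer: there is a monic polynomial with integer coefficients having s as a root. In particular, if s is rational then s is an integer, so matching cannot hold for any non-integer rational slope s. -/
/-- The piecewise affine map `Q_γ(x) = x + 1` for `x ≤ γ` and `Q_γ(x) = 1 + s(1 - x)` for
`x > γ`. -/
noncomputable def Q (s γ : ℝ) (x : ℝ) : ℝ := if x ≤ γ then x + 1 else 1 + s * (1 - x)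

/-- The lower orbit `ℓ_j = Q_γ^j(γ + 1)`, the forward orbit of the left-sided value
`Q_γ(γ⁻) = γ + 1`. -/
noncomputable def lowerOrbit (s γ : ℝ) (j : ℕ) : ℝ := (Q s γ)^[j] (γ + 1)

/-- The upper orbit `u_j = Q_γ^j(1 + s(1 - γ))`, the forward orbit of the right-sided value
`Q_γ(γ⁺) = 1 + s(1 - γ)`. -/
noncomputable def upperOrbit (s γ : ℝ) (j : ℕ) : ℝ := (Q s γ)^[j] (1 + s * (1 - γ))

open Classical in
/-- `Q_γ` satisfies the matching condition with matching exponents `κ⁻ = km ≥ 1`,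
`κ⁺ = kp ≥ 1`: the orbits `ℓ_{κ⁻ - 1} = u_{κ⁺ - 1}` meet, and the one-sided derivatives agree,
i.e. `#{0 ≤ j ≤ κ⁻ − 2 : ℓ_j > γ} = 1 + #{0 ≤ j ≤ κ⁺ − 2 : u_j > γ}`. -/
noncomputable def Matches (s γ : ℝ) (km kp : ℕ) : Prop :=
  1 ≤ km ∧ 1 ≤ kp ∧
  lowerOrbit s γ (km - 1) = upperOrbit s γ (kp - 1) ∧
  ((Finset.range (km - 1)).filter (fun j => γ < lowerOrbit s γ j)).card
    = 1 + ((Finset.range (kp - 1)).filter (fun j => γ < upperOrbit s γ j)).card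

open Polynomial in
open Classical in
/-- In the coordinate `x - 1` the branches of `Q s γ` are `y ↦ y + 1` and `y ↦ -s * y`, so an
iterate is a power of `-s` times the starting value plus an integer polynomial in `-s`. -/
theorem exists_iterate_Q_eq (s γ x : ℝ) (j : ℕ) :
    ∃ P : ℤ[X], P.natDegree ≤ ((Finset.range j).filter (fun i => γ < (Q s γ)^[i] x)).card ∧
      (Q s γ)^[j] x =
        1 + (-s) ^ ((Finset.range j).filter (fun i => γ < (Q s γ)^[i] x)).card * (x - 1)
          + aeval (-s) P := by
  induction j with
  | zero => exact ⟨0, by simp, by simp⟩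
  | succ j ih =>
    obtain ⟨P, hdeg, hP⟩ := ih
    rw [Finset.range_add_one, Finset.filter_insert, Function.iterate_succ_apply']
    by_cases hj : γ < (Q s γ)^[j] x
    · rw [if_pos hj, Finset.card_insert_of_notMem (by simp), Q, if_neg hj.not_ge]
      refine ⟨X * P, ?_, ?_⟩
      · grw [natDegree_mul_le, natDegree_X, hdeg, add_comm]
      · rw [hP, map_mul, aeval_X]
        ring
    · rw [if_neg hj, Q, if_pos (not_lt.mp hj)]
      refine ⟨P + 1, ?_, ?_⟩
      · grw [natDegree_add_le, natDegree_one, hdeg]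
        simp
      · rw [hP, map_add, map_one]
        ring

theorem lowerOrbit_succ (s γ : ℝ) (j : ℕ) :
    lowerOrbit s γ (j + 1) = (Q s γ)^[j] (1 - s * γ) := by
  rw [lowerOrbit, Function.iterate_succ_apply, Q, if_neg (by linarith)]
  congr 1
  ring

open Classical in
theorem card_filter_lowerOrbit_succ (s γ : ℝ) (j : ℕ) :
    ((Finset.range (j + 1)).filter (fun i => γ < lowerOrbit s γ i)).card
      = ((Finset.range j).filter (fun i => γ < (Q s γ)^[i] (1 - s * γ))).card + 1 := by
  simp only [Finset.card_filter, Finset.sum_range_succ', lowerOrbit_succ]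
  simp [lowerOrbit]

open Polynomial in
theorem Matches.isIntegral {s γ : ℝ} {km kp : ℕ} (h : Matches s γ km kp) : IsIntegral ℤ s := by
  classical
  obtain ⟨-, -, heq, hcard⟩ := h
  obtain hkm | ⟨j, hj⟩ : km - 1 = 0 ∨ ∃ j, km - 1 = j + 1 := by
    cases km - 1 <;> simp
  · rw [hkm, Finset.range_zero, Finset.filter_empty, Finset.card_empty] at hcard
    omega
  rw [hj, lowerOrbit_succ] at heq
  rw [hj, card_filter_lowerOrbit_succ, add_comm 1] at hcard
  obtain ⟨P, hPdeg, hP⟩ := exists_iterate_Q_eq s γ (1 - s * γ) j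
  obtain ⟨R, hRdeg, hR⟩ := exists_iterate_Q_eq s γ (1 + s * (1 - γ)) (kp - 1)
  set c := ((Finset.range (kp - 1)).filter
    (fun i => γ < (Q s γ)^[i] (1 + s * (1 - γ)))).card with hc
  rw [Nat.add_right_cancel hcard |>.trans hc.symm] at hP hPdeg
  rw [upperOrbit, hP, hR] at heq
  have hdeg : (P - R).degree < ((c + 1 : ℕ) : WithBot ℕ) := by
    refine lt_of_le_of_lt degree_le_natDegree (Nat.cast_lt.mpr (Nat.lt_succ_of_le ?_))
    exact (natDegree_sub_le P R).trans (max_le hPdeg hRdeg)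
  have hneg : IsIntegral ℤ (-s) := by
    refine ⟨X ^ (c + 1) + (P - R), monic_X_pow_add hdeg, ?_⟩
    rw [← aeval_def, map_add, map_pow, aeval_X, map_sub]
    linear_combination heq
  simpa using hneg.neg

/-- if for slope `s > 1` the map `Q_γ` satisfies the matching condition for some
`γ` and some matching exponents `κ⁻, κ⁺ ≥ 1`, then `s` is an algebraic integer; in particular,
if `s` is rational then it is an integer. -/
theorem matching_implies_algebraic_integer
    (s γ : ℝ) (hs : 1 < s) (km kp : ℕ) (h : Matches s γ km kp) :
    (∃ p : Polynomial ℤ, p.Monic ∧ Polynomial.aeval s p = 0) ∧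
    (∀ q : ℚ, (q : ℝ) = s → ∃ n : ℤ, (n : ℝ) = s) := by
  have hint := h.isIntegral
  refine ⟨hint, ?_⟩
  rintro q rfl
  have hq : IsIntegral ℤ q :=
    (isIntegral_algebraMap_iff (B := ℝ) (algebraMap ℚ ℝ).injective).mp hint
  obtain ⟨n, hn⟩ := IsIntegrallyClosed.isIntegral_iff.mp hq
  exact ⟨n, by rw [← hn]; simp⟩
end

section
/- Fix a real slope s > 1. Suppose γ₀ ∈ ℝ is such that γ₀ ∉ PM_{γ₀} and Q_{γ₀} satisfies the matching condition with matching exponents κ⁻, κ⁺. Then there is an open neighborhood U of γ₀ such that for every γ ∈ U the map Q_γ satisfies the matching condition with the same matching exponents κ⁻, κ⁺. -/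
/-- The prematching set `PM_γ = {ℓ_j : 0 ≤ j ≤ κ⁻ − 2} ∪ {u_j : 0 ≤ j ≤ κ⁺ − 2}`. -/
noncomputable def PMset (s γ : ℝ) (km kp : ℕ) : Set ℝ :=
  {x | ∃ j : ℕ, j + 2 ≤ km ∧ x = lowerOrbit s γ j} ∪
  {x | ∃ j : ℕ, j + 2 ≤ kp ∧ x = upperOrbit s γ j}

open Filter Topology in
/-- As long as the orbit of `f γ₀` under `Q_{γ₀}` avoids `γ₀`, the orbit of an affine function
`f γ` under `Q_γ` keeps its itinerary and stays affine for `γ` near `γ₀`; its slope is multiplied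
by `-s` at each visit above the discontinuity. -/
theorem eventually_iterate_Q_affine (s γ₀ c : ℝ) (f : ℝ → ℝ)
    (hf : ∀ γ, f γ = f γ₀ + c * (γ - γ₀)) (n : ℕ)
    (hn : ∀ j < n, (Q s γ₀)^[j] (f γ₀) ≠ γ₀) :
    ∀ᶠ γ in 𝓝 γ₀,
      (Q s γ)^[n] (f γ) = (Q s γ₀)^[n] (f γ₀) +
        (-s) ^ ((Finset.range n).filter (fun j => γ₀ < (Q s γ₀)^[j] (f γ₀))).card *
          (c * (γ - γ₀)) ∧
      ∀ j < n, (γ < (Q s γ)^[j] (f γ) ↔ γ₀ < (Q s γ₀)^[j] (f γ₀)) := by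
  induction n with
  | zero => exact .of_forall fun γ => ⟨by simpa using hf γ, by simp⟩
  | succ n ih =>
    have ih := ih fun j hj => hn j (by omega)
    have hne := hn n n.lt_succ_self
    rw [Finset.range_add_one, Finset.filter_insert]
    set k := ((Finset.range n).filter (fun j => γ₀ < (Q s γ₀)^[j] (f γ₀))).card with hk
    set x := (Q s γ₀)^[n] (f γ₀) with hx
    have hcont : Tendsto (fun γ => x + (-s) ^ k * (c * (γ - γ₀))) (𝓝 γ₀) (𝓝 x) := by
      have : Continuous fun γ => x + (-s) ^ k * (c * (γ - γ₀)) := by fun_prop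
      simpa using this.tendsto γ₀
    rcases lt_or_gt_of_ne hne with hlt | hgt
    · filter_upwards [ih, hcont.eventually_lt tendsto_id hlt] with γ ⟨hval, hit⟩ hside
      rw [← hval] at hside
      have hside : (Q s γ)^[n] (f γ) < γ := hside
      refine ⟨?_, fun j hj => ?_⟩
      · rw [Function.iterate_succ_apply', Function.iterate_succ_apply', ← hx,
          if_neg hlt.not_gt, ← hk, Q, if_pos hside.le, Q, if_pos hlt.le, hval]
        ring
      · rcases Nat.lt_succ_iff_lt_or_eq.mp hj with hj | rfl
        · exact hit j hj
        · exact iff_of_false hside.not_gt hlt.not_gt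
    · filter_upwards [ih, tendsto_id.eventually_lt hcont hgt] with γ ⟨hval, hit⟩ hside
      rw [← hval] at hside
      have hside : γ < (Q s γ)^[n] (f γ) := hside
      refine ⟨?_, fun j hj => ?_⟩
      · rw [Function.iterate_succ_apply', Function.iterate_succ_apply', ← hx,
          if_pos hgt, Finset.card_insert_of_notMem (by simp), ← hk, Q, if_neg hside.not_ge,
          Q, if_neg hgt.not_ge, hval]
        ring
      · rcases Nat.lt_succ_iff_lt_or_eq.mp hj with hj | rfl
        · exact hit j hj
        · exact iff_of_true hside hgt

/-- if `Q_{γ₀}` satisfies the matching condition with (minimal) matching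
exponents `κ⁻, κ⁺` and `γ₀ ∉ PM_{γ₀}`, then every `γ` in some open neighborhood of `γ₀`
satisfies the same matching condition with the same exponents. -/
theorem matching_is_stable
    (s γ₀ : ℝ) (hs : 1 < s) (km kp : ℕ)
    (h : Matches s γ₀ km kp)
    (hmin : ∀ km' kp' : ℕ, Matches s γ₀ km' kp' → km ≤ km' ∧ kp ≤ kp')
    (hPM : γ₀ ∉ PMset s γ₀ km kp) :
    ∃ U : Set ℝ, IsOpen U ∧ γ₀ ∈ U ∧ ∀ γ ∈ U, Matches s γ km kp := by
  obtain ⟨hkm, hkp, heq, hcard⟩ := h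
  have hl := eventually_iterate_Q_affine s γ₀ 1 (fun γ => γ + 1) (fun γ => by ring) (km - 1)
    fun j hj hc => hPM (Or.inl ⟨j, by omega, hc.symm⟩)
  have hu := eventually_iterate_Q_affine s γ₀ (-s) (fun γ => 1 + s * (1 - γ))
    (fun γ => by ring) (kp - 1) fun j hj hc => hPM (Or.inr ⟨j, by omega, hc.symm⟩)
  obtain ⟨U, hU, hUo, hmem⟩ := eventually_nhds_iff.mp (hl.and hu)
  refine ⟨U, hUo, hmem, fun γ hγ => ?_⟩
  obtain ⟨⟨hlv, hli⟩, huv, hui⟩ := hU γ hγ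
  refine ⟨hkm, hkp, ?_, ?_⟩
  · unfold lowerOrbit upperOrbit at *
    rw [hlv, huv, heq, hcard, pow_add]
    ring
  · unfold lowerOrbit upperOrbit at *
    rw [Finset.filter_congr fun j hj => hli j (Finset.mem_range.mp hj),
      Finset.filter_congr fun j hj => hui j (Finset.mem_range.mp hj)]
    exact hcard
end

section
/- Fix a real slope s > 1 and γ ∈ ℝ. There exists exactly one Borel probability measure μ on ℝ that is absolutely continuous with respect to Lebesgue measure and is Q_γ-invariant, i.e. μ(Q_γ^{-1}(A)) = μ(A) for every Borel set A. -/
open MeasureTheory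

open Set Filter Topology ENNReal

variable {s γ : ℝ}

/-- Slope of the affine branch of `Q s γ` at `x`. -/
noncomputable def slopeQ (s γ x : ℝ) : ℝ := if x ≤ γ then 1 else -s

/-- Slope of the affine branch of the `n`-th iterate of `Q s γ` at `x`. -/
noncomputable def slopeIter (s γ : ℝ) (n : ℕ) (x : ℝ) : ℝ :=
  ∏ k ∈ Finset.range n, slopeQ s γ ((Q s γ)^[k] x)

/-- Half-width parameter of the absorbing interval. -/
noncomputable def trapWidth (s γ : ℝ) : ℝ := 1 + |γ| + s * |1 - γ|

/-- A compact interval that is forward invariant under `Q s γ` and that every orbit enters. -/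
def trap (s γ : ℝ) : Set ℝ := Icc (1 - s * trapWidth s γ) (1 + trapWidth s γ)

lemma measurable_Q : Measurable (Q s γ) := by
  unfold Q
  exact Measurable.ite measurableSet_Iic (by fun_prop) (by fun_prop)

lemma Q_of_le {x : ℝ} (h : x ≤ γ) : Q s γ x = x + 1 := if_pos h

lemma Q_of_lt {x : ℝ} (h : γ < x) : Q s γ x = 1 + s * (1 - x) := if_neg h.not_ge

lemma trapWidth_bounds (hs : 1 < s) :
    1 ≤ trapWidth s γ ∧ γ ≤ trapWidth s γ ∧ s * (1 - γ) ≤ trapWidth s γ ∧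
      1 - s * trapWidth s γ ≤ γ := by
  have h1 := le_abs_self γ
  have h2 := neg_abs_le γ
  have h3 := mul_le_mul_of_nonneg_left (le_abs_self (1 - γ)) (by linarith : (0 : ℝ) ≤ s)
  have h4 : 0 ≤ s * |1 - γ| := by positivity
  have h5 := abs_nonneg γ
  have h6 : 1 ≤ trapWidth s γ := by unfold trapWidth; linarith
  refine ⟨h6, by unfold trapWidth; linarith, by unfold trapWidth; linarith, ?_⟩
  have : trapWidth s γ ≤ s * trapWidth s γ := by nlinarith
  have : 1 + |γ| ≤ trapWidth s γ := by unfold trapWidth; linarith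
  linarith

lemma mapsTo_Q_trap (hs : 1 < s) : MapsTo (Q s γ) (trap s γ) (trap s γ) := by
  obtain ⟨h1, h2, h3, h4⟩ := trapWidth_bounds (γ := γ) hs
  rintro x ⟨hx1, hx2⟩
  rcases le_or_gt x γ with h | h
  · rw [Q_of_le h]
    constructor <;> linarith
  · rw [Q_of_lt h]
    constructor <;> nlinarith

/-- The walk `x ↦ x + 1` carries a point at distance at most `n` below `γ` beyond `γ`. -/
lemma exists_iterate_mem_Ioc (n : ℕ) : ∀ x : ℝ, x ≤ γ → γ < x + n →
    ∃ j ≤ n, (Q s γ)^[j] x ∈ Ioc γ (γ + 1) := by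
  induction n with
  | zero => intro x h h'; simp at h'; linarith
  | succ n ih =>
    intro x hx h
    push_cast at h
    rcases le_or_gt (x + 1) γ with h1 | h1
    · obtain ⟨j, hj, hj'⟩ := ih (x + 1) h1 (by linarith)
      exact ⟨j + 1, by omega, by rwa [Function.iterate_succ_apply, Q_of_le hx]⟩
    · exact ⟨1, by omega, by simpa [Q_of_le hx] using h1, by simpa [Q_of_le hx] using hx⟩

lemma exists_iterate_mem_trap (hs : 1 < s) (x : ℝ) : ∃ n, (Q s γ)^[n] x ∈ trap s γ := by
  obtain ⟨h1, h2, h3, h4⟩ := trapWidth_bounds (γ := γ) hs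
  have key : ∀ y ≤ γ, ∃ n, (Q s γ)^[n] y ∈ trap s γ := by
    intro y hy
    obtain ⟨n, hn⟩ := exists_nat_gt (γ - y)
    obtain ⟨j, -, hj⟩ := exists_iterate_mem_Ioc (s := s) n y hy (by linarith)
    exact ⟨j, by linarith [hj.1], by linarith [hj.2]⟩
  rcases le_or_gt x γ with h | h
  · exact key x h
  rcases le_or_gt x (1 + trapWidth s γ) with h' | h'
  · exact ⟨0, by simpa using by linarith, by simpa using h'⟩
  · obtain ⟨n, hn⟩ := key (Q s γ x) (by rw [Q_of_lt h]; nlinarith)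
    exact ⟨n + 1, by rwa [Function.iterate_succ_apply]⟩

lemma one_le_abs_slopeQ (hs : 1 < s) (x : ℝ) : 1 ≤ |slopeQ s γ x| := by
  unfold slopeQ
  split_ifs
  · simp
  · rw [abs_neg, abs_of_pos (by linarith)]; exact hs.le

lemma one_le_abs_slopeIter (hs : 1 < s) (n : ℕ) (x : ℝ) : 1 ≤ |slopeIter s γ n x| := by
  rw [slopeIter, Finset.abs_prod]
  exact Finset.prod_induction _ (1 ≤ ·) (fun a b ha hb => one_le_mul_of_one_le_of_one_le ha hb) le_rfl
    fun k _ => one_le_abs_slopeQ hs _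

lemma slopeIter_add (m n : ℕ) (x : ℝ) :
    slopeIter s γ (m + n) x = slopeIter s γ m x * slopeIter s γ n ((Q s γ)^[m] x) := by
  simp only [slopeIter, Finset.prod_range_add]
  congr 1
  refine Finset.prod_congr rfl fun k _ => ?_
  rw [add_comm m k, Function.iterate_add_apply]

lemma slopeIter_succ (n : ℕ) (x : ℝ) :
    slopeIter s γ (n + 1) x = slopeIter s γ n x * slopeQ s γ ((Q s γ)^[n] x) :=
  Finset.prod_range_succ _ _

/-- Iterates of `Q s γ` are uniformly expanding on the absorbing interval. -/
lemma exists_le_abs_slopeIter (hs : 1 < s) (B : ℝ) :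
    ∃ N, 0 < N ∧ ∀ x ∈ trap s γ, B ≤ |slopeIter s γ N x| := by
  obtain ⟨K, hK⟩ := exists_nat_gt (γ - (1 - s * trapWidth s γ))
  have one : ∀ x ∈ trap s γ, s ≤ |slopeIter s γ (K + 1) x| := by
    intro x hx
    obtain ⟨j, hj, hjx⟩ : ∃ j ≤ K, γ < (Q s γ)^[j] x := by
      rcases le_or_gt x γ with h | h
      · obtain ⟨j, hj, hjx⟩ := exists_iterate_mem_Ioc (s := s) K x h (by linarith [hx.1])
        exact ⟨j, hj, hjx.1⟩
      · exact ⟨0, by omega, h⟩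
    obtain ⟨d, hd⟩ := Nat.exists_eq_add_of_le (Nat.succ_le_succ hj)
    rw [Nat.succ_eq_add_one, Nat.succ_eq_add_one] at hd
    rw [hd, slopeIter_add, slopeIter_succ, abs_mul, abs_mul]
    have h1 : |slopeQ s γ ((Q s γ)^[j] x)| = s := by
      rw [slopeQ, if_neg hjx.not_ge, abs_neg, abs_of_pos (by linarith)]
    rw [h1]
    have h2 := one_le_abs_slopeIter (γ := γ) hs j x
    have h3 := one_le_abs_slopeIter (γ := γ) hs d ((Q s γ)^[j + 1] x)
    calc s = 1 * s * 1 := by ring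
      _ ≤ _ := by gcongr
  have pow : ∀ n : ℕ, ∀ x ∈ trap s γ, s ^ n ≤ |slopeIter s γ ((K + 1) * n) x| := by
    intro n
    induction n with
    | zero => intro x _; simp [slopeIter]
    | succ n ih =>
      intro x hx
      rw [Nat.mul_succ, slopeIter_add, abs_mul, pow_succ]
      gcongr
      · exact ih x hx
      · exact one _ ((mapsTo_Q_trap hs).iterate _ hx)
  obtain ⟨n, hn⟩ := pow_unbounded_of_one_lt B hs
  refine ⟨(K + 1) * (n + 1), by positivity, fun x hx => ?_⟩
  refine hn.le.trans ((pow_le_pow_right₀ hs.le (Nat.le_succ n)).trans (pow (n + 1) x hx))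

lemma finite_iterate_preimage (hs : 1 < s) (n : ℕ) (y : ℝ) :
    {x | (Q s γ)^[n] x = y}.Finite := by
  induction n generalizing y with
  | zero => simp
  | succ n ih =>
    have : {x | (Q s γ)^[n + 1] x = y} = Q s γ ⁻¹' {x | (Q s γ)^[n] x = y} := by
      ext x; simp
    rw [this]
    refine (ih y).preimage' fun b _ => ?_
    refine (Set.toFinite {b - 1, 1 - (b - 1) / s}).subset fun x hx => ?_
    have hx : Q s γ x = b := hx
    rcases le_or_gt x γ with h | h
    · rw [Q_of_le h] at hx
      left; linarith
    · rw [Q_of_lt h] at hx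
      right
      have : s ≠ 0 := by linarith
      rw [mem_singleton_iff, ← hx]
      field_simp
      ring

/-- An iterate of `Q s γ` is affine on each interval avoiding the earlier preimages of `γ`. -/
lemma iterate_affineOn {n : ℕ} {I : Set ℝ} (hI : I.OrdConnected)
    (h : ∀ k < n, ∀ x ∈ I, (Q s γ)^[k] x ≠ γ) :
    ∃ a b : ℝ, ∀ x ∈ I, (Q s γ)^[n] x = a * x + b ∧ slopeIter s γ n x = a := by
  induction n with
  | zero => exact ⟨1, 0, fun x _ => by simp [slopeIter]⟩
  | succ n ih =>
    obtain ⟨a, b, hab⟩ := ih fun k hk => h k (by omega)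
    have side : (∀ x ∈ I, (Q s γ)^[n] x ≤ γ) ∨ (∀ x ∈ I, γ < (Q s γ)^[n] x) := by
      by_contra! hc
      obtain ⟨⟨x, hx, hx'⟩, y, hy, hy'⟩ := hc
      rw [(hab x hx).1] at hx'
      rw [(hab y hy).1] at hy'
      have himg : γ ∈ (fun z => a * z + b) '' uIcc x y :=
        intermediate_value_uIcc (by fun_prop) (by
          rw [uIcc_comm]; exact Icc_subset_uIcc ⟨hy', hx'.le⟩)
      obtain ⟨z, hz, hz'⟩ := himg
      have hzI := hI.uIcc_subset hx hy hz
      exact h n (by omega) z hzI ((hab z hzI).1.trans hz')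
    rcases side with hl | hr
    · refine ⟨a, b + 1, fun x hx => ?_⟩
      rw [Function.iterate_succ_apply', slopeIter_succ, Q_of_le (hl x hx), slopeQ,
        if_pos (hl x hx), (hab x hx).1, (hab x hx).2]
      constructor <;> ring
    · refine ⟨-s * a, 1 + s * (1 - b), fun x hx => ?_⟩
      rw [Function.iterate_succ_apply', slopeIter_succ, Q_of_lt (hr x hx), slopeQ,
        if_neg (hr x hx).not_ge, (hab x hx).1, (hab x hx).2]
      constructor <;> ring

/-- A finitely additive set function dominated by a finite measure is a measure. -/
lemma exists_measure_of_le_finite {α : Type*} [MeasurableSpace α] (ν : Measure α)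
    [IsFiniteMeasure ν] (m : Set α → ℝ≥0∞)
    (hadd : ∀ A B, MeasurableSet A → MeasurableSet B → Disjoint A B → m (A ∪ B) = m A + m B)
    (hle : ∀ A, MeasurableSet A → m A ≤ ν A) :
    ∃ μ : Measure α, ∀ A, MeasurableSet A → μ A = m A := by
  have h0 : m ∅ = 0 := by simpa using hle ∅ .empty
  refine ⟨Measure.ofMeasurable (fun A _ => m A) h0 ?_, fun A hA =>
    Measure.ofMeasurable_apply A hA⟩
  intro f hf hd
  have split : ∀ n, m (⋃ i, f i) = ∑ i ∈ Finset.range n, m (f i) + m (⋃ i, f (i + n)) := by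
    intro n
    induction n with
    | zero => simp
    | succ n ih =>
      have hU : (⋃ i, f (i + n)) = f n ∪ ⋃ i, f (i + (n + 1)) := by
        rw [← union_iUnion_nat_succ, zero_add]
        simp only [add_right_comm _ 1 n, add_assoc]
      rw [ih, hU, hadd _ _ (hf n) (.iUnion fun i => hf _), Finset.sum_range_succ, add_assoc]
      exact disjoint_iUnion_right.2 fun i => hd (by omega)
  have tail : Tendsto (fun n => m (⋃ i, f (i + n))) atTop (𝓝 0) := by
    refine tendsto_of_tendsto_of_tendsto_of_le_of_le tendsto_const_nhds
      (ENNReal.tendsto_sum_nat_add (fun i => ν (f i)) ?_) (fun _ => zero_le) fun n =>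
        (hle _ (.iUnion fun i => hf _)).trans (measure_iUnion_le _)
    rw [← measure_iUnion hd hf]
    exact measure_ne_top _ _
  have lim := (ENNReal.tendsto_nat_tsum fun i => m (f i)).add tail
  rw [add_zero] at lim
  exact tendsto_nhds_unique (tendsto_const_nhds.congr split) lim

/-- If the pushforwards of a probability measure under the iterates of `f` stay below a fixed
finite measure, then `f` has an invariant probability measure below the same measure. -/
lemma exists_invariant_le {α : Type*} [MeasurableSpace α] {f : α → α} (hf : Measurable f)
    (ν μ₀ : Measure α) [IsFiniteMeasure ν] [IsProbabilityMeasure μ₀]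
    (hle : ∀ n, μ₀.map f^[n] ≤ ν) :
    ∃ μ : Measure α, IsProbabilityMeasure μ ∧ μ ≤ ν ∧
      ∀ A, MeasurableSet A → μ (f ⁻¹' A) = μ A := by
  set a : ℕ → Set α → ℝ≥0∞ := fun n A =>
    ((n : ℝ≥0∞) + 1)⁻¹ * ∑ k ∈ Finset.range (n + 1), μ₀.map f^[k] A with ha
  have hn0 : ∀ n : ℕ, (n : ℝ≥0∞) + 1 ≠ 0 := fun n => by simp
  have hnt : ∀ n : ℕ, (n : ℝ≥0∞) + 1 ≠ ∞ := fun n => by simp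
  have avg : ∀ n A c, (∀ k, μ₀.map f^[k] A ≤ c) → a n A ≤ c := by
    intro n A c h
    calc a n A ≤ ((n : ℝ≥0∞) + 1)⁻¹ * ∑ k ∈ Finset.range (n + 1), c := by
          simp only [ha]; gcongr with k hk; exact h k
      _ = c := by
          rw [Finset.sum_const, Finset.card_range, nsmul_eq_mul, ← mul_assoc, Nat.cast_add,
            Nat.cast_one, ENNReal.inv_mul_cancel (hn0 n) (hnt n), one_mul]
  set F : Ultrafilter ℕ := hyperfilter ℕ
  have hF : (F : Filter ℕ) ≤ atTop := Nat.hyperfilter_le_atTop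
  set m : Set α → ℝ≥0∞ := fun A => (F.map fun n => a n A).lim
  have hm : ∀ A, Tendsto (fun n => a n A) F (𝓝 (m A)) := fun A =>
    (F.map fun n => a n A).le_nhds_lim
  have : NeBot (F : Filter ℕ) := F.neBot
  obtain ⟨μ, hμ⟩ := exists_measure_of_le_finite ν m
    (fun A B _ hB hd => by
      refine tendsto_nhds_unique (hm _) (((hm A).add (hm B)).congr fun n => ?_)
      simp only [ha]
      rw [← mul_add, ← Finset.sum_add_distrib]
      congr 1
      exact Finset.sum_congr rfl fun k _ => (measure_union hd hB).symm)
    (fun A _ => le_of_tendsto' (hm A) fun n => avg n A _ fun k => hle k A)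
  refine ⟨μ, ⟨?_⟩, Measure.le_iff.2 fun A hA => ?_, fun A hA => ?_⟩
  · rw [hμ _ .univ]
    refine tendsto_nhds_unique (hm _) (tendsto_const_nhds.congr fun n => ?_)
    have : ∀ k, μ₀.map f^[k] univ = 1 := fun k => by
      rw [Measure.map_apply (hf.iterate k) .univ, preimage_univ, measure_univ]
    simp only [ha, this, Finset.sum_const, Finset.card_range, nsmul_eq_mul, mul_one]
    rw [Nat.cast_add, Nat.cast_one, ENNReal.inv_mul_cancel (hn0 n) (hnt n)]
  · rw [hμ A hA]
    exact le_of_tendsto' (hm A) fun n => avg n A _ fun k => hle k A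
  · rw [hμ A hA, hμ _ (hf hA)]
    have hinv : Tendsto (fun n : ℕ => ((n : ℝ≥0∞) + 1)⁻¹) F (𝓝 0) := by
      have h := (tendsto_add_atTop_iff_nat 1).2 ENNReal.tendsto_inv_nat_nhds_zero
      refine (h.mono_left hF).congr fun n => by push_cast; rfl
    have small : ∀ k : ℕ → ℕ,
        Tendsto (fun n : ℕ => ((n : ℝ≥0∞) + 1)⁻¹ * μ₀.map f^[k n] A) F (𝓝 0) := by
      intro k
      refine tendsto_of_tendsto_of_tendsto_of_le_of_le tendsto_const_nhds hinv
        (fun _ => zero_le) fun n => ?_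
      calc _ ≤ ((n : ℝ≥0∞) + 1)⁻¹ * 1 := by
            gcongr
            have := Measure.isProbabilityMeasure_map (μ := μ₀) (hf.iterate (k n)).aemeasurable
            exact prob_le_one
        _ = _ := mul_one _
    have e1 := (hm (f ⁻¹' A)).add (small fun _ => 0)
    have e2 := (hm A).add (small fun n => n + 1)
    rw [add_zero] at e1 e2
    refine tendsto_nhds_unique e1 (e2.congr fun n => ?_)
    simp only [ha]
    rw [← mul_add, ← mul_add, ← Finset.sum_range_succ, Finset.sum_range_succ']
    congr 2
    refine Finset.sum_congr rfl fun k _ => ?_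
    rw [Measure.map_apply (hf.iterate _) hA, Measure.map_apply (hf.iterate _) (hf hA),
      Function.iterate_succ']
    rfl

lemma affine_preimage_Ioo {a : ℝ} (ha : a ≠ 0) (b l r : ℝ) :
    ∃ l' r', r' - l' = |a| * (r - l) ∧ (fun x => a * x + b) ⁻¹' Ioo l' r' = Ioo l r := by
  rcases ha.lt_or_gt with h | h
  · refine ⟨a * r + b, a * l + b, by rw [abs_of_neg h]; ring, ?_⟩
    ext x
    simp only [mem_preimage, mem_Ioo, add_lt_add_iff_right, mul_lt_mul_left_of_neg h]
    exact and_comm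
  · refine ⟨a * l + b, a * r + b, by rw [abs_of_pos h]; ring, ?_⟩
    ext x
    simp only [mem_preimage, mem_Ioo, add_lt_add_iff_right, mul_lt_mul_iff_right₀ h]

lemma map_affine_volume {a : ℝ} (ha : a ≠ 0) (b : ℝ) :
    (volume : Measure ℝ).map (fun x => a * x + b) = ENNReal.ofReal |a⁻¹| • volume := by
  have : (fun x => a * x + b) = (fun x => x + b) ∘ (fun x => a * x) := rfl
  rw [this, ← Measure.map_map (by fun_prop) (by fun_prop), Real.map_volume_mul_left ha,
    Measure.map_smul, map_add_right_eq_self]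

/-- If `f` is affine with slope `a` on `Ioo l r`, it carries Lebesgue measure on that interval to
a multiple of Lebesgue measure on the image interval. -/
lemma exists_map_volume_restrict_Ioo {f : ℝ → ℝ} {a b l r : ℝ} (ha : a ≠ 0)
    (hf : ∀ x ∈ Ioo l r, f x = a * x + b) :
    ∃ l' r', r' - l' = |a| * (r - l) ∧ f '' Ioo l r = Ioo l' r' ∧
      (volume.restrict (Ioo l r)).map f = ENNReal.ofReal |a⁻¹| • volume.restrict (Ioo l' r') := by
  obtain ⟨l', r', hlen, hpre⟩ := affine_preimage_Ioo ha b l r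
  refine ⟨l', r', hlen, ?_, ?_⟩
  · rw [image_congr hf, ← hpre, image_preimage_eq]
    intro y
    exact ⟨(y - b) / a, by field_simp; ring⟩
  · have : (volume.restrict (Ioo l r)).map f
        = (volume.restrict (Ioo l r)).map fun x => a * x + b :=
      Measure.map_congr (ae_restrict_of_forall_mem measurableSet_Ioo hf)
    rw [this, ← hpre, ← Measure.restrict_map (by fun_prop) measurableSet_Ioo,
      map_affine_volume ha, Measure.restrict_smul]

/-- `IsStep S a μ`: `μ` is a nonnegative combination, with total coefficient `a`, of Lebesgue
measures on open intervals contained in `S`. -/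
inductive IsStep (S : Set ℝ) : ℝ≥0∞ → Measure ℝ → Prop
  | zero : IsStep S 0 0
  | add {a a' : ℝ≥0∞} {μ μ' : Measure ℝ} :
      IsStep S a μ → IsStep S a' μ' → IsStep S (a + a') (μ + μ')
  | interval (c : ℝ≥0∞) {l r : ℝ} : Ioo l r ⊆ S → IsStep S c (c • volume.restrict (Ioo l r))

namespace IsStep

variable {S : Set ℝ} {a : ℝ≥0∞} {μ : Measure ℝ}

lemma smul (h : IsStep S a μ) (c : ℝ≥0∞) : IsStep S (c * a) (c • μ) := by
  induction h with
  | zero => simpa using zero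
  | add _ _ ih ih' => rw [mul_add, smul_add]; exact ih.add ih'
  | interval d h => rw [smul_smul]; exact interval _ h

lemma le_smul (h : IsStep S a μ) : μ ≤ a • volume.restrict S := by
  induction h with
  | zero => simp
  | add _ _ ih ih' => rw [add_smul]; exact add_le_add ih ih'
  | interval d h => gcongr

/-- If every interval in `S` has length at most `t` plus `R` times the measure of its part in `B`,
the corresponding bound holds for step measures. -/
lemma measure_univ_le (h : IsStep S a μ) {t R : ℝ≥0∞} {B : Set ℝ} (hB : MeasurableSet B)
    (hbad : ∀ l r, Ioo l r ⊆ S → volume (Ioo l r) ≤ t + R * volume (B ∩ Ioo l r)) :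
    μ univ ≤ t * a + R * μ B := by
  induction h with
  | zero => simp
  | add _ _ ih ih' =>
    simp only [Measure.add_apply]
    calc _ ≤ _ := add_le_add ih ih'
      _ = _ := by ring
  | @interval c l r h =>
    simp only [Measure.smul_apply, smul_eq_mul, Measure.restrict_apply hB,
      Measure.restrict_apply_univ]
    calc c * volume (Ioo l r) ≤ c * (t + R * volume (B ∩ Ioo l r)) := by gcongr; exact hbad l r h
      _ = _ := by ring

/-- A bound for the images of intervals extends to all step measures. -/
lemma map_of_interval {f : ℝ → ℝ} (hf : Measurable f) {κ C : ℝ≥0∞}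
    (hI : ∀ l r, Ioo l r ⊆ S → ∃ a' ≤ κ + C * volume (Ioo l r),
      IsStep S a' ((volume.restrict (Ioo l r)).map f))
    (h : IsStep S a μ) : ∃ a' ≤ κ * a + C * μ univ, IsStep S a' (μ.map f) := by
  induction h with
  | zero => exact ⟨0, zero_le, by simpa using zero⟩
  | add _ _ ih ih' =>
    obtain ⟨b, hb, h⟩ := ih
    obtain ⟨b', hb', h'⟩ := ih'
    refine ⟨b + b', ?_, by rw [Measure.map_add _ _ hf]; exact h.add h'⟩
    calc _ ≤ _ := add_le_add hb hb'
      _ = _ := by rw [Measure.add_apply]; ring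
  | @interval c l r h =>
    obtain ⟨b, hb, h⟩ := hI l r h
    refine ⟨c * b, ?_, by rw [Measure.map_smul]; exact h.smul c⟩
    calc c * b ≤ c * (κ + C * volume (Ioo l r)) := by gcongr
      _ = _ := by simp only [Measure.smul_apply, smul_eq_mul, Measure.restrict_apply_univ]; ring

/-- Iterating a contraction of the total coefficient. -/
lemma map_iterate {f : ℝ → ℝ} (hf : Measurable f) {C : ℝ≥0∞}
    (hstep : ∀ a μ, IsStep S a μ → ∃ a' ≤ 2⁻¹ * a + C * μ univ, IsStep S a' (μ.map f))
    (h : IsStep S a μ) (n : ℕ) :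
    ∃ a' ≤ 2⁻¹ ^ n * a + 2 * C * μ univ, IsStep S a' (μ.map f^[n]) := by
  induction n with
  | zero => exact ⟨a, by simp, by simpa using h⟩
  | succ n ih =>
    obtain ⟨b, hb, hμ⟩ := ih
    obtain ⟨b', hb', hμ'⟩ := hstep _ _ hμ
    refine ⟨b', hb'.trans ?_, by
      rw [Function.iterate_succ', ← Measure.map_map hf (hf.iterate n)]; exact hμ'⟩
    rw [Measure.map_apply (hf.iterate n) .univ, preimage_univ]
    calc _ ≤ 2⁻¹ * (2⁻¹ ^ n * a + 2 * C * μ univ) + C * μ univ := by gcongr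
      _ = 2⁻¹ ^ (n + 1) * a + (2⁻¹ * 2) * (C * μ univ) + C * μ univ := by ring
      _ = _ := by rw [ENNReal.inv_mul_cancel (by simp) (by simp)]; ring

end IsStep

lemma volume_restrict_Ioo_split {l d r : ℝ} (h : l ≤ d) (h' : d < r) :
    (volume : Measure ℝ).restrict (Ioo l r)
      = volume.restrict (Ioo l d) + volume.restrict (Ioo d r) := by
  rw [← Ioc_union_Ioo_eq_Ioo h h', Measure.restrict_union _ measurableSet_Ioo,
    restrict_Ioo_eq_restrict_Ioc (μ := volume) (a := l) (b := d)]
  exact disjoint_left.2 fun x hx hx' => hx.2.not_gt hx'.1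

lemma Set.Finite.exists_pos_le_dist {D : Set ℝ} (hD : D.Finite) :
    ∃ δ > 0, ∀ x ∈ D, ∀ y ∈ D, x ≠ y → δ ≤ dist x y := by
  by_cases h : D.Nontrivial
  · exact ⟨D.infsep, hD.infsep_pos_iff_nontrivial.2 h, fun x hx y hy hxy =>
      infsep_le_dist_of_mem hx hy hxy⟩
  · exact ⟨1, one_pos, fun x hx y hy hxy =>
      (h ⟨x, hx, y, hy, hxy⟩).elim⟩

lemma isStep_map_of_avoid {N : ℕ} (hs : 1 < s)
    (hN : ∀ x ∈ trap s γ, 4 ≤ |slopeIter s γ N x|)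
    {l r : ℝ} (hsub : Ioo l r ⊆ trap s γ)
    (h : ∀ k < N, ∀ x ∈ Ioo l r, (Q s γ)^[k] x ≠ γ) :
    ∃ a ≤ 4⁻¹, IsStep (trap s γ) a ((volume.restrict (Ioo l r)).map (Q s γ)^[N]) := by
  rcases (Ioo l r).eq_empty_or_nonempty with he | ⟨x, hx⟩
  · exact ⟨0, zero_le, by simpa [he] using IsStep.zero⟩
  obtain ⟨a, b, hab⟩ := iterate_affineOn ordConnected_Ioo h
  have ha : 4 ≤ |a| := by simpa [(hab x hx).2] using hN x (hsub hx)
  obtain ⟨l', r', -, himg, hmap⟩ := exists_map_volume_restrict_Ioo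
    (abs_pos.1 (by linarith)) fun x hx => (hab x hx).1
  refine ⟨_, ?_, hmap ▸ IsStep.interval _ ?_⟩
  · rw [abs_inv, ENNReal.ofReal_inv_of_pos (by linarith)]
    gcongr
    simpa using ENNReal.ofReal_le_ofReal ha
  · rw [← himg]
    exact (((mapsTo_Q_trap hs).iterate N).mono_left hsub).image_subset

lemma isStep_map_of_subsingleton {N : ℕ} (hs : 1 < s)
    (hN : ∀ x ∈ trap s γ, 4 ≤ |slopeIter s γ N x|)
    {l r : ℝ} (hsub : Ioo l r ⊆ trap s γ)
    (h : (Ioo l r ∩ {x | ∃ k < N, (Q s γ)^[k] x = γ}).Subsingleton) :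
    ∃ a ≤ 2⁻¹, IsStep (trap s γ) a ((volume.restrict (Ioo l r)).map (Q s γ)^[N]) := by
  have h42 : (4⁻¹ : ℝ≥0∞) + 4⁻¹ = 2⁻¹ := by
    rw [← ENNReal.toReal_eq_toReal_iff' (by simp) (by simp),
      ENNReal.toReal_add (by simp) (by simp)]
    norm_num
  by_cases hd : ∃ d ∈ Ioo l r, ∃ k < N, (Q s γ)^[k] d = γ
  · obtain ⟨d, hd, hdk⟩ := hd
    obtain ⟨a, ha, h1⟩ := isStep_map_of_avoid hs hN
      ((Ioo_subset_Ioo_right hd.2.le).trans hsub) fun k hk x hx hxk =>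
        hx.2.ne (h ⟨⟨hx.1, hx.2.trans hd.2⟩, k, hk, hxk⟩ ⟨hd, hdk⟩)
    obtain ⟨a', ha', h2⟩ := isStep_map_of_avoid hs hN
      ((Ioo_subset_Ioo_left hd.1.le).trans hsub) fun k hk x hx hxk =>
        hx.1.ne' (h ⟨⟨hd.1.trans hx.1, hx.2⟩, k, hk, hxk⟩ ⟨hd, hdk⟩)
    refine ⟨a + a', h42 ▸ add_le_add ha ha', ?_⟩
    rw [volume_restrict_Ioo_split hd.1.le hd.2, Measure.map_add _ _ (measurable_Q.iterate N)]
    exact h1.add h2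
  · push Not at hd
    obtain ⟨a, ha, h1⟩ := isStep_map_of_avoid hs hN hsub fun k hk x hx => hd x hx k hk
    exact ⟨a, ha.trans (h42 ▸ le_self_add), h1⟩

/-- The Lasota–Yorke type inequality for step measures. -/
lemma exists_isStep_map {N : ℕ} (hs : 1 < s)
    (hN : ∀ x ∈ trap s γ, 4 ≤ |slopeIter s γ N x|) :
    ∃ C : ℝ≥0∞, C ≠ 0 ∧ C ≠ ∞ ∧ ∀ a μ, IsStep (trap s γ) a μ →
    ∃ a' ≤ 2⁻¹ * a + C * μ univ, IsStep (trap s γ) a' (μ.map (Q s γ)^[N]) := by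
  have hfin : {x | ∃ k < N, (Q s γ)^[k] x = γ}.Finite := by
    have : {x | ∃ k < N, (Q s γ)^[k] x = γ} = ⋃ k ∈ Iio N, {x | (Q s γ)^[k] x = γ} := by
      ext x; simp
    rw [this]
    exact (finite_Iio N).biUnion fun k _ => finite_iterate_preimage hs k γ
  obtain ⟨δ, hδ, hsep⟩ := hfin.exists_pos_le_dist
  have short : ∀ l r, r - l ≤ δ → Ioo l r ⊆ trap s γ →
      ∃ a ≤ 2⁻¹, IsStep (trap s γ) a ((volume.restrict (Ioo l r)).map (Q s γ)^[N]) := by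
    refine fun l r hlr hsub => isStep_map_of_subsingleton hs hN hsub fun x hx y hy => ?_
    by_contra hxy
    have h1 := hsep x hx.2 y hy.2 hxy
    have h2 : dist x y < r - l := by
      rw [Real.dist_eq, abs_lt]
      constructor <;> linarith [hx.1.1, hx.1.2, hy.1.1, hy.1.2]
    linarith
  have long : ∀ n : ℕ, ∀ l r, r - l ≤ (n + 1) * δ → Ioo l r ⊆ trap s γ →
      ∃ a ≤ ((n : ℝ≥0∞) + 1) * 2⁻¹,
        IsStep (trap s γ) a ((volume.restrict (Ioo l r)).map (Q s γ)^[N]) := by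
    intro n
    induction n with
    | zero => intro l r h; simpa using short l r (by simpa using h)
    | succ n ih =>
      intro l r hlr hsub
      rcases le_or_gt (r - l) δ with h | h
      · obtain ⟨a, ha, h1⟩ := short l r h hsub
        refine ⟨a, ha.trans ?_, h1⟩
        calc (2⁻¹ : ℝ≥0∞) = 1 * 2⁻¹ := (one_mul _).symm
          _ ≤ _ := by gcongr; exact le_add_self
      · obtain ⟨a, ha, h1⟩ := short l (l + δ) (by linarith)
          ((Ioo_subset_Ioo_right (by linarith)).trans hsub)
        obtain ⟨a', ha', h2⟩ := ih (l + δ) r (by push_cast at hlr; linarith)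
          ((Ioo_subset_Ioo_left (by linarith)).trans hsub)
        refine ⟨a + a', (add_le_add ha ha').trans (by push_cast; ring_nf; rfl), ?_⟩
        rw [volume_restrict_Ioo_split (d := l + δ) (by linarith) (by linarith),
          Measure.map_add _ _ (measurable_Q.iterate N)]
        exact h1.add h2
  refine ⟨ENNReal.ofReal δ⁻¹, by simpa using hδ, by simp, fun a μ h =>
    h.map_of_interval (measurable_Q.iterate N) fun l r hsub => ?_⟩
  rcases le_or_gt r l with hlr | hlr
  · exact ⟨0, zero_le, by simpa [Ioo_eq_empty_of_le hlr] using IsStep.zero⟩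
  have hq : 0 ≤ (r - l) / δ := div_nonneg (by linarith) hδ.le
  obtain ⟨b, hb, h1⟩ := long ⌊(r - l) / δ⌋₊ l r
    ((div_le_iff₀ hδ).1 (Nat.lt_floor_add_one _).le) hsub
  refine ⟨b, hb.trans ?_, h1⟩
  rw [add_mul, one_mul, add_comm, Real.volume_Ioo, ← ENNReal.ofReal_mul (by positivity),
    mul_comm δ⁻¹, ← div_eq_mul_inv]
  gcongr
  calc (⌊(r - l) / δ⌋₊ : ℝ≥0∞) * 2⁻¹ ≤ ⌊(r - l) / δ⌋₊ * 1 := by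
        gcongr; exact ENNReal.inv_le_one.2 (by norm_num)
    _ = ENNReal.ofReal ⌊(r - l) / δ⌋₊ := by simp
    _ ≤ _ := ENNReal.ofReal_le_ofReal (Nat.floor_le hq)

lemma volume_trap_lt_top : volume (trap s γ) < ∞ := measure_Icc_lt_top

lemma trap_endpoints_lt (hs : 1 < s) : 1 - s * trapWidth s γ < 1 + trapWidth s γ := by
  have := (trapWidth_bounds (γ := γ) hs).1
  nlinarith

lemma quasiMeasurePreserving_Q (hs : 1 < s) :
    Measure.QuasiMeasurePreserving (Q s γ) volume volume := by
  refine ⟨measurable_Q, Measure.AbsolutelyContinuous.mk fun A hA h0 => ?_⟩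
  rw [Measure.map_apply measurable_Q hA]
  have key : ∀ a b : ℝ, a ≠ 0 → volume ((fun x => a * x + b) ⁻¹' A) = 0 := by
    intro a b ha
    rw [← Measure.map_apply (by fun_prop) hA, map_affine_volume ha, Measure.smul_apply, h0,
      smul_zero]
  refine measure_mono_null (fun x hx => ?_)
    (measure_union_null (key 1 1 one_ne_zero) (key (-s) (1 + s) (by linarith)))
  have hx : Q s γ x ∈ A := hx
  rcases le_or_gt x γ with h | h
  · left
    rw [Q_of_le h] at hx
    simpa using hx
  · right
    rw [Q_of_lt h] at hx
    have e : -s * x + (1 + s) = 1 + s * (1 - x) := by ring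
    simpa only [mem_preimage, e] using hx

/-- Averaging an invariant measure of an iterate yields an invariant measure. -/
lemma exists_invariant_of_iterate {α : Type*} [MeasurableSpace α] {f : α → α} {ν μ : Measure α}
    (hf : Measure.QuasiMeasurePreserving f ν ν) {N : ℕ} (hN : 0 < N) [IsProbabilityMeasure μ]
    (hμν : μ ≪ ν) (hμ : ∀ A, MeasurableSet A → μ (f^[N] ⁻¹' A) = μ A) :
    ∃ μ' : Measure α, IsProbabilityMeasure μ' ∧ μ' ≪ ν ∧
      ∀ A, MeasurableSet A → μ' (f ⁻¹' A) = μ' A := by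
  have hm : ∀ k, Measurable f^[k] := hf.measurable.iterate
  have hN0 : (N : ℝ≥0∞) ≠ 0 := by simpa using hN.ne'
  have eval : ∀ A, MeasurableSet A → ((N : ℝ≥0∞)⁻¹ • ∑ k ∈ Finset.range N, μ.map f^[k]) A
      = (N : ℝ≥0∞)⁻¹ * ∑ k ∈ Finset.range N, μ (f^[k] ⁻¹' A) := by
    intro A hA
    rw [Measure.smul_apply, Measure.finsetSum_apply, smul_eq_mul]
    congr 1
    exact Finset.sum_congr rfl fun k _ => Measure.map_apply (hm k) hA
  refine ⟨(N : ℝ≥0∞)⁻¹ • ∑ k ∈ Finset.range N, μ.map f^[k], ⟨?_⟩,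
    Measure.AbsolutelyContinuous.mk fun A hA h0 => ?_, fun A hA => ?_⟩
  · simp [eval _ .univ, ENNReal.inv_mul_cancel hN0]
  · rw [eval A hA, Finset.sum_eq_zero fun k _ => hμν ((hf.iterate k).preimage_null h0), mul_zero]
  · rw [eval A hA, eval _ (hf.measurable hA)]
    congr 1
    have h : ∀ k, μ (f^[k] ⁻¹' (f ⁻¹' A)) = μ (f^[k + 1] ⁻¹' A) := fun k => by
      rw [Function.iterate_succ', preimage_comp]
    simp only [h]
    obtain ⟨n, rfl⟩ := Nat.exists_eq_succ_of_ne_zero hN.ne'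
    rw [Finset.sum_range_succ, hμ A hA, Finset.sum_range_succ']
    rfl

lemma exists_acip (hs : 1 < s) :
    ∃ μ : Measure ℝ, IsProbabilityMeasure μ ∧ μ ≪ volume ∧
      ∀ A : Set ℝ, MeasurableSet A → μ (Q s γ ⁻¹' A) = μ A := by
  obtain ⟨N, hN0, hN⟩ := exists_le_abs_slopeIter (γ := γ) hs 4
  obtain ⟨C, -, hC, hstep⟩ := exists_isStep_map hs hN
  set I : Set ℝ := Ioo (1 - s * trapWidth s γ) (1 + trapWidth s γ)
  have hI0 : volume I ≠ 0 :=
    (isOpen_Ioo.measure_pos volume (nonempty_Ioo.2 (trap_endpoints_lt hs))).ne'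
  have hIt : volume I ≠ ∞ := measure_Ioo_lt_top.ne
  have h0 : IsStep (trap s γ) (volume I)⁻¹ ((volume I)⁻¹ • volume.restrict I) :=
    .interval _ Ioo_subset_Icc_self
  have : IsProbabilityMeasure ((volume I)⁻¹ • volume.restrict I) := ⟨by
    simp [ENNReal.inv_mul_cancel hI0 hIt]⟩
  have hK : (volume I)⁻¹ + 2 * C ≠ ∞ := by
    simp [hI0, ENNReal.mul_eq_top, hC]
  have : IsFiniteMeasure (volume.restrict (trap s γ)) := ⟨by simpa using volume_trap_lt_top⟩
  have := Measure.smul_finite (volume.restrict (trap s γ)) hK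
  obtain ⟨μ, hμ, hle, hinv⟩ := exists_invariant_le (measurable_Q.iterate N)
    (((volume I)⁻¹ + 2 * C) • volume.restrict (trap s γ)) ((volume I)⁻¹ • volume.restrict I)
    (fun n => by
      obtain ⟨a, ha, h⟩ := h0.map_iterate (measurable_Q.iterate N) hstep n
      refine h.le_smul.trans ?_
      gcongr
      refine ha.trans ?_
      rw [measure_univ, mul_one]
      gcongr
      exact mul_le_of_le_one_left zero_le
        (pow_le_one₀ zero_le (ENNReal.inv_le_one.2 (by norm_num))))
  exact exists_invariant_of_iterate (quasiMeasurePreserving_Q hs) hN0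
    (hle.absolutelyContinuous.trans
      (Measure.smul_absolutelyContinuous.trans Measure.absolutelyContinuous_restrict)) hinv

/-- Near a Lebesgue density point of `A` there are intervals mostly filled by `A`. -/
lemma exists_Ioo_measure_compl_inter_le {A : Set ℝ} {p q : ℝ} (hA : MeasurableSet A)
    (hpos : volume (A ∩ Icc p q) ≠ 0) {ε : ℝ≥0∞} (hε : ε ≠ 0) :
    ∃ l r, l < r ∧ Ioo l r ⊆ Icc p q ∧ volume (Aᶜ ∩ Ioo l r) ≤ ε * volume (Ioo l r) := by
  obtain ⟨x, hx, hxI⟩ : ∃ x, (Tendsto (fun δ => volume (A ∩ Metric.closedBall x δ)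
      / volume (Metric.closedBall x δ)) (𝓝[>] 0) (𝓝 1)) ∧ x ∈ Ioo p q := by
    have hd := IsUnifLocDoublingMeasure.ae_tendsto_measure_inter_div (volume : Measure ℝ) A 1
    have hne : (ae (volume.restrict (A ∩ Ioo p q))).NeBot := by
      rw [ae_neBot, Ne, Measure.restrict_eq_zero]
      rwa [← measure_congr ((ae_eq_refl A).inter Ioo_ae_eq_Icc)] at hpos
    have hd' := ae_restrict_of_ae_restrict_of_subset (inter_subset_left (t := Ioo p q)) hd
    obtain ⟨x, h1, h2⟩ := (hd'.and (ae_restrict_mem (hA.inter measurableSet_Ioo))).exists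
    refine ⟨x, h1 (fun _ => x) id tendsto_id ?_, h2.2⟩
    filter_upwards [self_mem_nhdsWithin] with δ hδ
    exact Metric.mem_closedBall_self (by simpa using (mem_Ioi.1 hδ).le)
  have e1 := hx.eventually_const_lt (ENNReal.sub_lt_self one_ne_top one_ne_zero hε)
  have e2 : ∀ᶠ δ in 𝓝[>] (0 : ℝ), Ioo (x - δ) (x + δ) ⊆ Icc p q := by
    have : Ioo (0 : ℝ) (min (x - p) (q - x)) ∈ 𝓝[>] (0 : ℝ) :=
      Ioo_mem_nhdsGT (lt_min (by linarith [hxI.1]) (by linarith [hxI.2]))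
    filter_upwards [this] with δ hδ y hy
    have h1 := hδ.2.trans_le (min_le_left _ _)
    have h2 := hδ.2.trans_le (min_le_right _ _)
    constructor <;> linarith [hy.1, hy.2]
  obtain ⟨δ, ⟨h1, h2⟩, hδ⟩ := ((e1.and e2).and self_mem_nhdsWithin).exists
  have hδ : 0 < δ := hδ
  refine ⟨x - δ, x + δ, by linarith, h2, ?_⟩
  rw [Real.closedBall_eq_Icc, ← measure_congr ((ae_eq_refl A).inter Ioo_ae_eq_Icc),
    ← measure_congr (Ioo_ae_eq_Icc (μ := volume) (a := x - δ) (b := x + δ))] at h1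
  set V := volume (Ioo (x - δ) (x + δ))
  have hV : V ≠ ∞ := measure_Ioo_lt_top.ne
  have hsum : volume (A ∩ Ioo (x - δ) (x + δ)) + volume (Aᶜ ∩ Ioo (x - δ) (x + δ)) = V := by
    rw [inter_comm A, inter_comm Aᶜ]
    exact measure_inter_add_sdiff _ hA
  have hfin : volume (A ∩ Ioo (x - δ) (x + δ)) ≠ ∞ :=
    ne_top_of_le_ne_top hV (measure_mono inter_subset_right)
  refine (ENNReal.add_le_add_iff_left hfin).1 ?_
  rw [hsum]
  calc V = 1 * V := (one_mul V).symm
    _ ≤ ((1 - ε) + ε) * V := by gcongr; exact le_tsub_add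
    _ = (1 - ε) * V + ε * V := add_mul _ _ _
    _ ≤ _ := by
      gcongr
      exact ENNReal.mul_le_of_le_div h1.le

/-- If `B` meets every subinterval of a compact interval in positive measure, then it does so
uniformly for all subintervals of length more than `τ`. -/
lemma exists_volume_Ioo_le {p q : ℝ} {B : Set ℝ}
    (hB : ∀ l r, l < r → Ioo l r ⊆ Icc p q → volume (B ∩ Ioo l r) ≠ 0) {τ : ℝ} (hτ : 0 < τ) :
    ∃ R : ℝ≥0∞, R ≠ ∞ ∧ ∀ l r, Ioo l r ⊆ Icc p q →
      volume (Ioo l r) ≤ ENNReal.ofReal τ + R * volume (B ∩ Ioo l r) := by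
  classical
  set h := τ / 3 with hh
  have hpos : 0 < h := by positivity
  set cell : ℤ → Set ℝ := fun k => Ioo (k * h) ((k + 1) * h)
  set F := (Finset.Icc ⌊p / h⌋ ⌈q / h⌉).filter fun k => cell k ⊆ Icc p q
  set η : ℝ≥0∞ := min (F.inf fun k => volume (B ∩ cell k)) 1
  have hη0 : η ≠ 0 := by
    refine (lt_min ((Finset.lt_inf_iff (by simp)).2 fun k hk => ?_) one_pos).ne'
    exact pos_iff_ne_zero.2 (hB _ _ (by nlinarith) (Finset.mem_filter.1 hk).2)
  have hηt : η ≠ ∞ := ne_top_of_le_ne_top one_ne_top (min_le_right _ _)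
  refine ⟨volume (Icc p q) / η, ENNReal.div_ne_top measure_Icc_lt_top.ne hη0,
    fun l r hsub => ?_⟩
  rcases le_or_gt (r - l) τ with hlr | hlr
  · rw [Real.volume_Ioo]
    exact (ENNReal.ofReal_le_ofReal hlr).trans le_self_add
  set k := ⌊l / h⌋ + 1 with hk
  have k1 : l < k * h := (div_lt_iff₀ hpos).1 (by rw [hk]; push_cast; exact Int.lt_floor_add_one _)
  have k2 : (k - 1) * h ≤ l := (le_div_iff₀ hpos).1 (by
    rw [hk]; push_cast; rw [add_sub_cancel_right]; exact Int.floor_le _)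
  have k3 : (k + 1) * h < r := by nlinarith
  have hcl : cell k ⊆ Ioo l r := Ioo_subset_Ioo k1.le k3.le
  obtain ⟨hp, hq⟩ : p ≤ l ∧ r ≤ q := by
    have := closure_mono hsub
    rw [closure_Ioo (by linarith), isClosed_Icc.closure_eq] at this
    exact (Icc_subset_Icc_iff (by linarith)).1 this
  have hkF : k ∈ F := by
    refine Finset.mem_filter.2 ⟨Finset.mem_Icc.2 ⟨?_, ?_⟩, hcl.trans hsub⟩
    · exact Int.cast_le.1 ((Int.floor_le _).trans ((div_le_iff₀ hpos).2 (hp.trans k1.le)))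
    · exact Int.cast_le.1 (((le_div_iff₀ hpos).2 (by nlinarith)).trans (Int.le_ceil _))
  calc volume (Ioo l r) ≤ volume (Icc p q) := measure_mono hsub
    _ = volume (Icc p q) / η * η := (ENNReal.div_mul_cancel hη0 hηt).symm
    _ ≤ volume (Icc p q) / η * volume (B ∩ Ioo l r) := by
      gcongr
      exact (min_le_left _ _).trans ((Finset.inf_le hkF).trans
        (measure_mono (inter_subset_inter_right _ hcl)))
    _ ≤ _ := le_add_self

lemma iterate_preimage_eq_of_preimage_eq {α : Type*} {f : α → α} {A : Set α} (h : f ⁻¹' A = A)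
    (n : ℕ) : f^[n] ⁻¹' A = A := by
  rw [Set.preimage_iterate_eq]
  exact (Function.IsFixedPt.iterate (f := preimage f) h n)

/-- An invariant set meeting the absorbing interval in positive measure has full measure in some
interval. -/
lemma exists_Ioo_compl_null (hs : 1 < s) {A : Set ℝ} (hA : MeasurableSet A)
    (hinv : Q s γ ⁻¹' A = A) (hpos : volume (A ∩ trap s γ) ≠ 0) :
    ∃ l r, l < r ∧ Ioo l r ⊆ trap s γ ∧ volume (Aᶜ ∩ Ioo l r) = 0 := by
  by_contra! hcon
  obtain ⟨N, -, hN⟩ := exists_le_abs_slopeIter (γ := γ) hs 4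
  obtain ⟨C, hC0, hC, hstep⟩ := exists_isStep_map hs hN
  set t : ℝ≥0∞ := (2 * (3 * C))⁻¹ with ht
  have ht0 : t ≠ 0 := ENNReal.inv_ne_zero.2 (by finiteness)
  have htt : t ≠ ∞ := ENNReal.inv_ne_top.2 (mul_ne_zero (by simp) (mul_ne_zero (by simp) hC0))
  obtain ⟨R, hR, hbad⟩ := exists_volume_Ioo_le hcon (ENNReal.toReal_pos ht0 htt)
  rw [ENNReal.ofReal_toReal htt] at hbad
  obtain ⟨l, r, hlr, hsub, hle⟩ := exists_Ioo_measure_compl_inter_le hA hpos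
    (ε := (4 * (R + 1))⁻¹) (ENNReal.inv_ne_zero.2 (by finiteness))
  set b := volume (Ioo l r) with hb
  have hb0 : b ≠ 0 := (isOpen_Ioo.measure_pos volume (nonempty_Ioo.2 hlr)).ne'
  have hbt : b ≠ ∞ := measure_Ioo_lt_top.ne
  have hpow : Tendsto (fun n : ℕ => (2⁻¹ : ℝ≥0∞) ^ n) atTop (𝓝 0) :=
    ENNReal.tendsto_pow_atTop_nhds_zero_of_lt_one (ENNReal.inv_lt_one.2 (by norm_num))
  obtain ⟨n, hn⟩ := (hpow.eventually_lt_const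
    (pos_iff_ne_zero.2 (mul_ne_zero hC0 hb0))).exists
  have h0 : IsStep (trap s γ) 1 (volume.restrict (Ioo l r)) := by
    simpa only [one_smul] using IsStep.interval (S := trap s γ) 1 hsub
  have hG := measurable_Q (s := s) (γ := γ).iterate N
  obtain ⟨a, ha, h⟩ := h0.map_iterate hG hstep n
  have ha' : a ≤ 3 * C * b := by
    refine ha.trans ?_
    rw [Measure.restrict_apply_univ, mul_one]
    calc _ ≤ C * b + 2 * C * b := by gcongr
      _ = _ := by ring
  have hmain := h.measure_univ_le hA.compl hbad
  have hAc : ((Q s γ)^[N])^[n] ⁻¹' Aᶜ = Aᶜ :=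
    iterate_preimage_eq_of_preimage_eq (iterate_preimage_eq_of_preimage_eq
      (by rw [preimage_compl, hinv]) N) n
  rw [Measure.map_apply (hG.iterate n) .univ, preimage_univ, Measure.restrict_apply_univ,
    Measure.map_apply (hG.iterate n) hA.compl, hAc, Measure.restrict_apply hA.compl] at hmain
  have s1 : t * a ≤ 2⁻¹ * b := by
    calc t * a ≤ t * (3 * C * b) := by gcongr
      _ = 2⁻¹ * ((3 * C)⁻¹ * (3 * C)) * b := by
        rw [ht, ENNReal.mul_inv (by simp) (by simp)]; ring
      _ = _ := by
        rw [ENNReal.inv_mul_cancel (mul_ne_zero (by simp) hC0) (by finiteness), mul_one]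
  have s2 : R * volume (Aᶜ ∩ Ioo l r) ≤ 4⁻¹ * b := by
    calc _ ≤ (R + 1) * ((4 * (R + 1))⁻¹ * b) := by gcongr; exact le_self_add
      _ = 4⁻¹ * ((R + 1) * (R + 1)⁻¹) * b := by
        rw [ENNReal.mul_inv (by simp) (by simp)]; ring
      _ = _ := by rw [ENNReal.mul_inv_cancel (by simp) (by finiteness), mul_one]
  have : b < b := by
    calc b ≤ 2⁻¹ * b + 4⁻¹ * b := hmain.trans (add_le_add s1 s2)
      _ = (2⁻¹ + 4⁻¹) * b := (add_mul _ _ _).symm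
      _ < 1 * b := by
        refine (ENNReal.mul_lt_mul_iff_left hb0 hbt).2 ?_
        rw [← ENNReal.toReal_lt_toReal (by finiteness) (by simp),
          ENNReal.toReal_add (by simp) (by simp)]
        norm_num
      _ = b := one_mul b
  exact this.false

/-- Such a set even has full measure in a neighbourhood of the discontinuity `γ`. -/
lemma exists_Ioo_mem_compl_null (hs : 1 < s) {A : Set ℝ} (hA : MeasurableSet A)
    (hinv : Q s γ ⁻¹' A = A) (hpos : volume (A ∩ trap s γ) ≠ 0) :
    ∃ l r, γ ∈ Ioo l r ∧ volume (Aᶜ ∩ Ioo l r) = 0 := by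
  classical
  obtain ⟨l, r, hlr, hsub, hnull⟩ := exists_Ioo_compl_null hs hA hinv hpos
  have hit : ∃ n, ∃ x ∈ Ioo l r, (Q s γ)^[n] x = γ := by
    by_contra! hcon
    set L := 1 + trapWidth s γ - (1 - s * trapWidth s γ)
    obtain ⟨N, -, hN⟩ := exists_le_abs_slopeIter (γ := γ) hs ((L + 1) / (r - l))
    obtain ⟨a, b, hab⟩ := iterate_affineOn ordConnected_Ioo fun k (_ : k < N) => hcon k
    obtain ⟨x, hx⟩ := nonempty_Ioo.2 hlr
    have ha := hN x (hsub hx)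
    have ha1 := one_le_abs_slopeIter (γ := γ) hs N x
    rw [(hab x hx).2] at ha ha1
    obtain ⟨l', r', hlen, himg, -⟩ := exists_map_volume_restrict_Ioo
      (abs_pos.1 (by linarith)) fun x hx => (hab x hx).1
    have himg' := (((mapsTo_Q_trap hs).iterate N).mono_left hsub).image_subset
    rw [himg] at himg'
    have hv := measure_mono (μ := volume) himg'
    rw [trap, Real.volume_Ioo, Real.volume_Icc,
      ENNReal.ofReal_le_ofReal_iff (by linarith [trap_endpoints_lt (γ := γ) hs]), hlen] at hv
    rw [div_le_iff₀ (by linarith)] at ha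
    linarith
  obtain ⟨x, hx, hxγ⟩ := Nat.find_spec hit
  obtain ⟨a, b, hab⟩ := iterate_affineOn ordConnected_Ioo
    (fun k hk y hy hyk => Nat.find_min hit hk ⟨y, hy, hyk⟩)
  have ha1 := one_le_abs_slopeIter (γ := γ) hs (Nat.find hit) x
  rw [(hab x hx).2] at ha1
  have ha0 : a ≠ 0 := abs_pos.1 (by linarith)
  obtain ⟨l', r', -, himg, hmap⟩ := exists_map_volume_restrict_Ioo ha0
    fun x hx => (hab x hx).1
  refine ⟨l', r', himg ▸ ⟨x, hx, hxγ⟩, ?_⟩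
  have hev := congrArg (fun μ : Measure ℝ => μ Aᶜ) hmap
  simp only [Measure.smul_apply, smul_eq_mul, Measure.restrict_apply hA.compl] at hev
  rw [Measure.map_apply (measurable_Q.iterate _) hA.compl, iterate_preimage_eq_of_preimage_eq
    (by rw [preimage_compl, hinv]), Measure.restrict_apply hA.compl, hnull, eq_comm,
    mul_eq_zero] at hev
  refine hev.resolve_left ?_
  simpa using ha0

lemma measure_compl_trap_eq_zero (hs : 1 < s) {μ : Measure ℝ} [IsProbabilityMeasure μ]
    (hμ : MeasurePreserving (Q s γ) μ μ) : μ (trap s γ)ᶜ = 0 := by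
  have hU : ⋃ n, (Q s γ)^[n] ⁻¹' trap s γ = univ :=
    eq_univ_of_forall fun x => mem_iUnion.2 (exists_iterate_mem_trap hs x)
  have hmono : Monotone fun n => (Q s γ)^[n] ⁻¹' trap s γ := by
    refine monotone_nat_of_le_succ fun n x hx => ?_
    rw [mem_preimage, Function.iterate_succ_apply']
    exact mapsTo_Q_trap hs hx
  have h1 := hmono.measure_iUnion (μ := μ)
  have hm : MeasurableSet (trap s γ) := measurableSet_Icc
  simp only [fun n => (hμ.iterate n).measure_preimage hm.nullMeasurableSet, ciSup_const] at h1
  rw [prob_compl_eq_zero_iff hm, ← h1, hU, measure_univ]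

lemma ergodic_of_acip (hs : 1 < s) {μ : Measure ℝ} [IsProbabilityMeasure μ] (hac : μ ≪ volume)
    (hμ : MeasurePreserving (Q s γ) μ μ) : Ergodic (Q s γ) μ := by
  refine ⟨hμ, ⟨fun A hA hinv => ?_⟩⟩
  have null_of : ∀ B, volume (B ∩ trap s γ) = 0 → μ B = 0 := fun B h =>
    measure_mono_null (fun x hx => by
      by_cases hxt : x ∈ trap s γ
      · exact Or.inl ⟨hx, hxt⟩
      · exact Or.inr hxt) (measure_union_null (hac h) (measure_compl_trap_eq_zero hs hμ))
  rw [eventuallyConst_set]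
  by_cases h1 : volume (A ∩ trap s γ) = 0
  · exact Or.inr (measure_eq_zero_iff_ae_notMem.1 (null_of A h1))
  by_cases h2 : volume (Aᶜ ∩ trap s γ) = 0
  · exact Or.inl (null_of Aᶜ h2)
  obtain ⟨l, r, hγ, h⟩ := exists_Ioo_mem_compl_null hs hA hinv h1
  obtain ⟨l', r', hγ', h'⟩ := exists_Ioo_mem_compl_null hs hA.compl
    (by rw [preimage_compl, hinv]) h2
  have hpos : volume (Ioo l r ∩ Ioo l' r') ≠ 0 :=
    ((isOpen_Ioo.inter isOpen_Ioo).measure_pos volume ⟨γ, hγ, hγ'⟩).ne'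
  refine (hpos (measure_mono_null (fun x hx => ?_) (measure_union_null h h'))).elim
  by_cases hxA : x ∈ A
  · exact Or.inr ⟨not_not_intro hxA, hx.2⟩
  · exact Or.inl ⟨hxA, hx.1⟩

/-- for every slope `s > 1` and every `γ` there is exactly one Borel probability
measure on `ℝ` that is absolutely continuous with respect to Lebesgue measure and is
`Q_γ`-invariant. -/
theorem exists_unique_acip (s γ : ℝ) (hs : 1 < s) :
    ∃! μ : Measure ℝ, IsProbabilityMeasure μ ∧ μ ≪ volume ∧
      ∀ A : Set ℝ, MeasurableSet A → μ (Q s γ ⁻¹' A) = μ A := by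
  refine existsUnique_of_exists_of_unique (exists_acip hs) ?_
  rintro μ ν ⟨_, hμ, hμi⟩ ⟨_, hν, hνi⟩
  have preserving : ∀ ρ : Measure ℝ, (∀ A, MeasurableSet A → ρ (Q s γ ⁻¹' A) = ρ A) →
      MeasurePreserving (Q s γ) ρ ρ := fun ρ h =>
    ⟨measurable_Q, Measure.ext fun A hA => by rw [Measure.map_apply measurable_Q hA, h A hA]⟩
  have half : (2⁻¹ : ℝ≥0∞) ≠ 0 := by simp
  set ρ : Measure ℝ := (2⁻¹ : ℝ≥0∞) • (μ + ν) with hρ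
  have : IsProbabilityMeasure ρ := ⟨by
    simp [hρ, ENNReal.inv_two_add_inv_two]⟩
  have hρi : MeasurePreserving (Q s γ) ρ ρ := preserving ρ fun A hA => by
    simp [hρ, hμi A hA, hνi A hA]
  have hρac : ρ ≪ volume := Measure.smul_absolutelyContinuous.trans
    (Measure.AbsolutelyContinuous.add_left hμ hν)
  have herg := ergodic_of_acip hs hρac hρi
  have sub : ∀ σ : Measure ℝ, σ ≪ μ + ν → σ ≪ ρ := fun σ h =>
    h.trans (Measure.absolutelyContinuous_smul half)
  have h1 := herg.eq_of_absolutelyContinuous (preserving μ hμi)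
    (sub μ (Measure.le_add_right le_rfl).absolutelyContinuous)
  have h2 := herg.eq_of_absolutelyContinuous (preserving ν hνi)
    (sub ν (Measure.le_add_left le_rfl).absolutelyContinuous)
  exact h1.trans h2.symm
end

section
/- Fix an integer s ≥ 2. Let γ₀ ∈ (0,1) and let p₀ ∈ (γ₀, 1] be a periodic point of Q_{γ₀}, i.e. Q_{γ₀}^{j₀}(p₀) = p₀ for some j₀ ≥ 1. If p₀ ∈ E, then there exists δ > 0 such that (p₀ − δ, p₀) ∩ E = ∅; that is, p₀ is the right endpoint of a matching interval. -/
/-- The map `g(x) = s(1 − x) mod 1`. -/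
noncomputable def gmap (s : ℕ) (x : ℝ) : ℝ := Int.fract ((s : ℝ) * (1 - x))

/-- The bifurcation set `E = {γ ∈ [0,1] : g^k(γ) ≥ γ for all k ≥ 1}`. -/
noncomputable def Eset (s : ℕ) : Set ℝ :=
  {γ ∈ Set.Icc (0 : ℝ) 1 | ∀ k : ℕ, 1 ≤ k → γ ≤ (gmap s)^[k] γ}

open Filter Topology

theorem gmap_fract (s : ℕ) (x : ℝ) : gmap s (Int.fract x) = Int.fract (1 + (s : ℝ) * (1 - x)) := by
  have h : (s : ℝ) * (1 - Int.fract x) = s * (1 - x) + ((s * ⌊x⌋ : ℤ) : ℝ) := by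
    rw [← Int.self_sub_floor]
    push_cast
    ring
  rw [gmap, h, Int.fract_add_intCast, add_comm, Int.fract_add_one]

/-- Modulo one, orbits of `Q` follow orbits of `gmap`. -/
theorem exists_fract_iterate_Q_eq (s : ℕ) (γ x : ℝ) (n : ℕ) :
    ∃ k : ℕ, Int.fract ((Q s γ)^[n] x) = (gmap s)^[k] (Int.fract x) ∧
      (k = 0 → (Q s γ)^[n] x = x + n) := by
  induction n with
  | zero => exact ⟨0, by simp⟩
  | succ n ih =>
    obtain ⟨k, hk, hk0⟩ := ih
    rw [Function.iterate_succ_apply']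
    by_cases h : (Q s γ)^[n] x ≤ γ
    · refine ⟨k, ?_, fun h0 => ?_⟩
      · rw [Q, if_pos h, Int.fract_add_one, hk]
      · rw [Q, if_pos h, hk0 h0]
        push_cast
        ring
    · refine ⟨k + 1, ?_, fun h0 => absurd h0 k.succ_ne_zero⟩
      rw [Q, if_neg h, Function.iterate_succ_apply', ← hk, gmap_fract]

theorem eventually_gmap_eq {s : ℕ} {y : ℝ} (hy : gmap s y ≠ 0) :
    ∀ᶠ x in 𝓝 y, gmap s x = gmap s y + -(s : ℝ) * (x - y) := by
  have hc : ContinuousAt (fun x : ℝ => (s : ℝ) * (1 - x)) y := by fun_prop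
  have hlo : (⌊(s : ℝ) * (1 - y)⌋ : ℝ) < s * (1 - y) := by
    have h := lt_of_le_of_ne (Int.fract_nonneg ((s : ℝ) * (1 - y))) (Ne.symm hy)
    rw [← Int.self_sub_floor] at h
    linarith
  filter_upwards [hc.eventually_const_lt hlo, hc.eventually_lt_const (Int.lt_floor_add_one _)]
    with x h1 h2
  have hf : ⌊(s : ℝ) * (1 - x)⌋ = ⌊(s : ℝ) * (1 - y)⌋ := Int.floor_eq_iff.2 ⟨h1.le, h2⟩
  rw [gmap, gmap, ← Int.self_sub_floor, ← Int.self_sub_floor, hf]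
  ring

/-- If the orbit of `p` avoids `0`, then the iterates of `gmap` are affine near `p`. -/
theorem eventually_iterate_gmap_eq {s : ℕ} {p : ℝ} (hp : ∀ k : ℕ, 1 ≤ k → (gmap s)^[k] p ≠ 0)
    (n : ℕ) :
    ∀ᶠ x in 𝓝 p, (gmap s)^[n] x = (gmap s)^[n] p + (-(s : ℝ)) ^ n * (x - p) := by
  induction n with
  | zero => simp
  | succ n ih =>
    have ht : Tendsto ((gmap s)^[n]) (𝓝 p) (𝓝 ((gmap s)^[n] p)) := by
      have hc : ContinuousAt (fun x => (gmap s)^[n] p + (-(s : ℝ)) ^ n * (x - p)) p := by fun_prop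
      exact (hc.congr_of_eventuallyEq ih).tendsto
    have hn := hp (n + 1) n.succ_pos
    rw [Function.iterate_succ_apply'] at hn
    filter_upwards [ih, ht.eventually (eventually_gmap_eq hn)] with x h1 h2
    rw [Function.iterate_succ_apply', Function.iterate_succ_apply', h2, h1]
    ring

/-- let `γ₀ ∈ (0,1)` and let `p₀ ∈ (γ₀, 1]` be a periodic point of `Q_{γ₀}`.
If `p₀ ∈ E` then some interval `(p₀ − δ, p₀)` is disjoint from `E`, i.e. `p₀` is the right
endpoint of a matching interval. -/
theorem periodic_bifurcation_is_right_endpoint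
    (s : ℕ) (hs : 2 ≤ s) (γ₀ p₀ : ℝ) (hγ : γ₀ ∈ Set.Ioo (0 : ℝ) 1)
    (hp : γ₀ < p₀) (hp1 : p₀ ≤ 1)
    (j₀ : ℕ) (hj : 1 ≤ j₀) (hper : (Q s γ₀)^[j₀] p₀ = p₀)
    (hE : p₀ ∈ Eset s) :
    ∃ δ > (0 : ℝ), Set.Ioo (p₀ - δ) p₀ ∩ Eset s = ∅ := by
  have hp0 : 0 < p₀ := hγ.1.trans hp
  obtain ⟨-, hE⟩ := hE
  have hlt : p₀ < 1 := by
    have h := hE 1 le_rfl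
    rw [Function.iterate_one] at h
    exact h.trans_lt (Int.fract_lt_one _)
  have hfr : Int.fract p₀ = p₀ := Int.fract_eq_self.2 ⟨hp0.le, hlt⟩
  obtain ⟨k, hk, hk0⟩ := exists_fract_iterate_Q_eq s γ₀ p₀ j₀
  rw [hper, hfr] at hk
  have hkpos : k ≠ 0 := by
    intro h
    have h1 := hk0 h
    have h2 : (1 : ℝ) ≤ j₀ := by exact_mod_cast hj
    linarith
  have hfix : (gmap s)^[2 * k] p₀ = p₀ := by
    rw [two_mul, Function.iterate_add_apply, ← hk, ← hk]
  obtain ⟨δ, hδ, hball⟩ := Metric.eventually_nhds_iff.1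
    (eventually_iterate_gmap_eq (fun n hn => (hp0.trans_le (hE n hn)).ne') (2 * k))
  refine ⟨δ, hδ, Set.eq_empty_iff_forall_notMem.2 ?_⟩
  rintro x ⟨⟨hx1, hx2⟩, -, hxE⟩
  have hx := hball (y := x) (by rw [Real.dist_eq, abs_lt]; constructor <;> linarith)
  have hge := hxE (2 * k) (by omega)
  have hs1 : (1 : ℝ) < s := by exact_mod_cast hs
  have hpow : (1 : ℝ) < (s : ℝ) ^ (2 * k) := one_lt_pow₀ hs1 (by omega)
  rw [hx, hfix, (even_two_mul k).neg_pow] at hge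
  nlinarith
end

section
/- Fix an integer s ≥ 2. Then the bifurcation set E is contained in [0, s/(s+1)] and has Lebesgue measure zero. -/
open MeasureTheory

theorem Ergodic.measure_setOf_forall_iterate_notMem {α : Type*} [MeasurableSpace α]
    {μ : Measure α} [IsFiniteMeasure μ] {f : α → α} (hf : Ergodic f μ) {U : Set α}
    (hU : MeasurableSet U) (hμU : μ U ≠ 0) : μ {y | ∀ k : ℕ, f^[k] y ∉ U} = 0 := by
  have hmeas : MeasurableSet {y | ∀ k : ℕ, f^[k] y ∉ U} := by
    rw [Set.ofPred_forall]
    exact MeasurableSet.iInter fun k => (hf.measurable.iterate k hU).compl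
  have hle : {y | ∀ k : ℕ, f^[k] y ∉ U} ⊆ f ⁻¹' {y | ∀ k : ℕ, f^[k] y ∉ U} :=
    fun y hy k => hy (k + 1)
  rcases hf.ae_empty_or_univ_of_ae_le_preimage hmeas.nullMeasurableSet hle.eventuallyLE
    with h | h
  · exact ae_eq_empty.mp h
  · refine absurd (measure_mono_null ?_ (ae_eq_univ.mp h)) hμU
    exact fun y hy hy' => hy' 0 hy

theorem coe_fract_unitAddCircle (x : ℝ) : ((Int.fract x : ℝ) : UnitAddCircle) = x := by
  rw [← sub_eq_zero, ← AddCircle.coe_sub, AddCircle.coe_eq_zero_iff]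
  exact ⟨-⌊x⌋, by rw [← Int.self_sub_floor]; simp⟩

theorem coe_gmap (s : ℕ) (x : ℝ) :
    ((gmap s x : ℝ) : UnitAddCircle) = (-(s : ℤ)) • (x : UnitAddCircle) := by
  rw [gmap, coe_fract_unitAddCircle, ← AddCircle.coe_zsmul, ← sub_eq_zero, ← AddCircle.coe_sub,
    AddCircle.coe_eq_zero_iff]
  exact ⟨s, by simp; ring⟩

theorem coe_iterate_gmap (s k : ℕ) (x : ℝ) :
    (((gmap s)^[k] x : ℝ) : UnitAddCircle) =
      (fun y : UnitAddCircle => (-(s : ℤ)) • y)^[k] (x : UnitAddCircle) :=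
  (Function.Semiconj.iterate_right (f := ((↑) : ℝ → UnitAddCircle)) (coe_gmap s) k).eq x

theorem Eset_subset_Icc (s : ℕ) : Eset s ⊆ Set.Icc (0 : ℝ) ((s : ℝ) / (s + 1)) := by
  rintro x ⟨⟨h0, h1⟩, h⟩
  refine ⟨h0, ?_⟩
  have hx : x ≤ Int.fract ((s : ℝ) * (1 - x)) := h 1 le_rfl
  have hnonneg : 0 ≤ (s : ℝ) * (1 - x) := mul_nonneg s.cast_nonneg (by linarith)
  have hle : Int.fract ((s : ℝ) * (1 - x)) ≤ (s : ℝ) * (1 - x) := by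
    have : (0 : ℝ) ≤ ⌊(s : ℝ) * (1 - x)⌋ := by exact_mod_cast Int.floor_nonneg.mpr hnonneg
    linarith [Int.self_sub_floor ((s : ℝ) * (1 - x))]
  rw [le_div_iff₀ (by positivity)]
  linarith

theorem lt_one_of_mem_Eset {s : ℕ} {x : ℝ} (hx : x ∈ Eset s) : x < 1 :=
  (hx.2 1 le_rfl).trans_lt (Int.fract_lt_one _)

theorem iterate_gmap_mem_Ico {s : ℕ} {x : ℝ} (hx : x ∈ Set.Ico (0 : ℝ) 1) (k : ℕ) :
    (gmap s)^[k] x ∈ Set.Ico (0 : ℝ) 1 := by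
  cases k with
  | zero => exact hx
  | succ k =>
    rw [Function.iterate_succ_apply']
    exact ⟨Int.fract_nonneg _, Int.fract_lt_one _⟩

theorem volume_Eset_inter_Ioc {s : ℕ} (hs : 2 ≤ s) {c : ℝ} (hc : 0 < c) :
    volume (Eset s ∩ Set.Ioc c 1) = 0 := by
  set U : Set UnitAddCircle := (↑) '' Set.Ioo (0 : ℝ) c
  have hopen : IsOpen U := QuotientAddGroup.isOpenMap_coe _ isOpen_Ioo
  have herg : Ergodic (fun y : UnitAddCircle => (-(s : ℤ)) • y) :=
    AddCircle.ergodic_zsmul (by rw [abs_neg, Nat.abs_cast]; exact_mod_cast hs)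
  have hnull := herg.measure_setOf_forall_iterate_notMem hopen.measurableSet
    (hopen.measure_ne_zero volume ((Set.nonempty_Ioo.mpr hc).image _))
  have hpre := (UnitAddCircle.measurePreserving_mk 0).quasiMeasurePreserving.preimage_null hnull
  rw [zero_add, Measure.restrict_apply' measurableSet_Ioc] at hpre
  refine measure_mono_null ?_ hpre
  rintro x ⟨hx, hcx, hx1⟩
  refine ⟨?_, hc.trans hcx, hx1⟩
  rintro k ⟨t, ⟨ht0, htc⟩, ht⟩
  have hmem := iterate_gmap_mem_Ico (s := s) ⟨hx.1.1, lt_one_of_mem_Eset hx⟩ k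
  have hk : x ≤ (gmap s)^[k] x := by
    rcases Nat.eq_zero_or_pos k with rfl | hk
    · exact le_rfl
    · exact hx.2 k hk
  rw [← coe_iterate_gmap, AddCircle.coe_eq_coe_iff_of_mem_Ico (a := 0)
    ⟨ht0.le, by linarith⟩ (by simpa using hmem)] at ht
  linarith

/-- for integer slope `s ≥ 2` the bifurcation set `E` is contained in
`[0, s/(s+1)]` and has Lebesgue measure zero. -/
theorem bifurcation_set_measure_zero (s : ℕ) (hs : 2 ≤ s) :
    Eset s ⊆ Set.Icc (0 : ℝ) ((s : ℝ) / (s + 1)) ∧ volume (Eset s) = 0 := by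
  refine ⟨Eset_subset_Icc s, ?_⟩
  have hcover : Eset s ⊆ {0} ∪ ⋃ n : ℕ, Eset s ∩ Set.Ioc (1 / ((n : ℝ) + 1)) 1 := by
    intro x hx
    rcases hx.1.1.eq_or_lt with h0 | h0
    · exact Or.inl h0.symm
    · obtain ⟨n, hn⟩ := exists_nat_one_div_lt h0
      exact Or.inr (Set.mem_iUnion.mpr ⟨n, hx, hn, hx.1.2⟩)
  refine measure_mono_null hcover (measure_union_null Real.volume_singleton ?_)
  exact measure_iUnion_null fun n => volume_Eset_inter_Ioc hs Nat.one_div_pos_of_nat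
end

section
/- Fix an integer s ≥ 2. The Hausdorff dimension of the bifurcation set E equals 1, while for every δ > 0 the Hausdorff dimension of E \ [0, δ) is strictly less than 1. -/
open Set Filter Topology MeasureTheory
open scoped NNReal ENNReal

section Orbits

lemma gmap_eq_fract_neg_mul (s : ℕ) (x : ℝ) : gmap s x = Int.fract (-(s : ℝ) * x) := by
  rw [gmap, Int.fract_eq_fract]
  exact ⟨s, by push_cast; ring⟩

lemma gmap_iterate (s : ℕ) (x : ℝ) {k : ℕ} (hk : 1 ≤ k) :
    (gmap s)^[k] x = Int.fract ((-(s : ℝ)) ^ k * x) := by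
  induction k, hk using Nat.le_induction with
  | base => simp [gmap_eq_fract_neg_mul]
  | succ k _ ih =>
    rw [Function.iterate_succ_apply', ih, gmap_eq_fract_neg_mul, Int.fract_eq_fract]
    refine ⟨s * ⌊(-(s : ℝ)) ^ k * x⌋, ?_⟩
    rw [Int.fract]
    push_cast
    ring

lemma mem_Eset_of_le_abs_sub {s : ℕ} {γ : ℝ} (h₀ : 0 ≤ γ) (h₁ : γ ≤ 1)
    (h : ∀ k : ℕ, 1 ≤ k → ∀ n : ℤ, γ ≤ |(s : ℝ) ^ k * γ - n|) : γ ∈ Eset s := by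
  refine ⟨⟨h₀, h₁⟩, fun k hk => ?_⟩
  rw [gmap_iterate s γ hk, ← abs_of_nonneg (Int.fract_nonneg ((-(s : ℝ)) ^ k * γ)),
    Int.fract]
  rcases Nat.even_or_odd k with hk' | hk'
  · simpa [hk'.neg_pow] using h k hk ⌊(-(s : ℝ)) ^ k * γ⌋
  · have := h k hk (-⌊(-(s : ℝ)) ^ k * γ⌋)
    rw [← abs_neg] at this
    rw [hk'.neg_pow] at this ⊢
    convert this using 2
    push_cast
    ring

end Orbits

section HausdorffDimension

/-- If `ψ` factors through `φ` by a Hölder map, the dimensions of the ranges compare. -/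
lemma le_dimH_range_of_edist_le {α X Y : Type*} [EMetricSpace X] [EMetricSpace Y] [Nonempty α]
    {C r : ℝ≥0} (hr : 0 < r) {φ : α → X} {ψ : α → Y}
    (h : ∀ a b, edist (ψ a) (ψ b) ≤ C * edist (φ a) (φ b) ^ (r : ℝ)) :
    dimH (range ψ) ≤ dimH (range φ) / r := by
  have hinv : ∀ a, φ (Function.invFun φ (φ a)) = φ a := fun a => Function.invFun_eq ⟨a, rfl⟩
  have hψ : ∀ a, ψ (Function.invFun φ (φ a)) = ψ a := fun a => by
    have := h (Function.invFun φ (φ a)) a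
    rw [hinv, edist_self, ENNReal.zero_rpow_of_pos (by exact_mod_cast hr), mul_zero] at this
    exact edist_le_zero.1 this
  have hold : HolderOnWith C r (ψ ∘ Function.invFun φ) (range φ) := by
    rintro _ ⟨a, rfl⟩ _ ⟨b, rfl⟩
    simpa only [Function.comp, hψ] using h a b
  convert hold.dimH_image_le hr using 2
  rw [← range_comp]
  exact congrArg range (funext fun a => (hψ a).symm)

/-- A set of reals in `[0, 1)` whose base `M` expansions avoid the digit `0` has Hausdorff dimension
less than `1`. -/
lemma dimH_lt_one_of_inv_le_fract {M : ℕ} (hM : 2 ≤ M) {F : Set ℝ}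
    (hF : ∀ x ∈ F, x ∈ Ico (0 : ℝ) 1 ∧ ∀ k : ℕ, (M : ℝ)⁻¹ ≤ Int.fract ((M : ℝ) ^ k * x)) :
    dimH F < 1 := by
  have hM' : (2 : ℝ) ≤ M := by exact_mod_cast hM
  have hM0 : (0 : ℝ) < M := by linarith
  obtain ⟨S, hcard, hS⟩ : ∃ S : ℕ → Finset ℤ, (∀ n, (S n).card ≤ (M - 1) ^ n) ∧
      ∀ n, ∀ x ∈ F, ⌊(M : ℝ) ^ n * x⌋ ∈ S n := by
    suffices ∀ n, ∃ S : Finset ℤ, S.card ≤ (M - 1) ^ n ∧ ∀ x ∈ F, ⌊(M : ℝ) ^ n * x⌋ ∈ S by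
      choose S hS using this
      exact ⟨S, fun n => (hS n).1, fun n => (hS n).2⟩
    intro n
    induction n with
    | zero =>
      refine ⟨{0}, by simp, fun x hx => ?_⟩
      simpa [Int.floor_eq_zero_iff] using (hF x hx).1
    | succ n ih =>
      obtain ⟨S, hc, hS⟩ := ih
      refine ⟨(S ×ˢ Finset.Ico (1 : ℤ) M).image fun p => M * p.1 + p.2, ?_, fun x hx => ?_⟩
      · refine Finset.card_image_le.trans ?_
        rw [Finset.card_product, pow_succ, Int.card_Ico]
        exact Nat.mul_le_mul hc (by omega)
      · have hfr := (hF x hx).2 n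
        set y := (M : ℝ) ^ n * x with hy
        have hlt := Int.fract_lt_one y
        refine Finset.mem_image.2 ⟨(⌊y⌋, ⌊(M : ℝ) * Int.fract y⌋), ?_, ?_⟩
        · refine Finset.mem_product.2 ⟨hS x hx, Finset.mem_Ico.2 ⟨?_, ?_⟩⟩
          · rw [Int.le_floor]
            have := mul_le_mul_of_nonneg_left hfr hM0.le
            rw [mul_inv_cancel₀ hM0.ne'] at this
            exact_mod_cast this
          · rw [Int.floor_lt]
            push_cast
            nlinarith
        · have : (M : ℝ) ^ (n + 1) * x = M * Int.fract y + ((M * ⌊y⌋ : ℤ) : ℝ) := by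
            rw [Int.fract, hy]
            push_cast
            ring
          rw [this, Int.floor_add_intCast]
          ring
  set d : ℝ≥0 := ⟨Real.logb M (M - 1 : ℝ), Real.logb_nonneg (by linarith) (by linarith)⟩
  have hd1 : d < 1 := by
    rw [← NNReal.coe_lt_coe]
    change Real.logb M (M - 1 : ℝ) < 1
    rw [Real.logb_lt_iff_lt_rpow (by linarith) (by linarith)]
    simp
  have hMd : (M : ℝ) ^ (d : ℝ) = M - 1 := by
    change (M : ℝ) ^ (Real.logb M (M - 1 : ℝ)) = M - 1
    exact Real.rpow_logb hM0 (by linarith) (by linarith)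
  refine lt_of_le_of_lt (dimH_le_of_hausdorffMeasure_ne_top (d := d) ?_)
    (by exact_mod_cast hd1)
  have hediam : ∀ n (j : S n), Metric.ediam (Icc ((j : ℤ) / (M : ℝ) ^ n) (((j : ℤ) + 1) / (M : ℝ) ^ n))
      = ENNReal.ofReal (((M : ℝ)⁻¹) ^ n) := fun n j => by
    rw [Real.ediam_Icc]
    congr 1
    rw [inv_pow]
    ring
  have hbound := Measure.hausdorffMeasure_le_liminf_sum (ι := fun n => S n) (d : ℝ) F (l := atTop)
    (fun n => ENNReal.ofReal (((M : ℝ)⁻¹) ^ n))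
    (by
      have := tendsto_pow_atTop_nhds_zero_of_lt_one (inv_nonneg.2 hM0.le)
        (inv_lt_one_of_one_lt₀ (by linarith : (1 : ℝ) < M))
      simpa using ENNReal.tendsto_ofReal this)
    (fun n j => Icc ((j : ℤ) / (M : ℝ) ^ n) (((j : ℤ) + 1) / (M : ℝ) ^ n))
    (Eventually.of_forall fun n j => (hediam n j).le)
    (Eventually.of_forall fun n x hx => mem_iUnion.2 ⟨⟨_, hS n x hx⟩, by
      have hp : (0 : ℝ) < (M : ℝ) ^ n := by positivity
      rw [mem_Icc, div_le_iff₀ hp, le_div_iff₀ hp, mul_comm x]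
      exact ⟨Int.floor_le _, (Int.lt_floor_add_one _).le⟩⟩)
  refine ne_top_of_le_ne_top ENNReal.one_ne_top (hbound.trans ?_)
  refine (liminf_le_liminf (v := fun _ => (1 : ℝ≥0∞)) (Eventually.of_forall fun n => ?_)).trans
    (by simp)
  simp only [hediam]
  rw [Finset.sum_const, nsmul_eq_mul, Finset.card_univ, Fintype.card_coe,
    ENNReal.ofReal_rpow_of_nonneg (by positivity) d.coe_nonneg, ← ENNReal.ofReal_natCast,
    ← ENNReal.ofReal_mul (by positivity), ENNReal.ofReal_le_one,
    ← Real.rpow_natCast, ← Real.rpow_mul (by positivity), mul_comm (n : ℝ),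
    Real.rpow_mul (by positivity), Real.inv_rpow hM0.le, hMd, Real.rpow_natCast, inv_pow]
  have hpos : (0 : ℝ) < ((M : ℝ) - 1) ^ n := pow_pos (by linarith) n
  rw [← div_eq_mul_inv, div_le_one hpos]
  have := hcard n
  calc ((S n).card : ℝ) ≤ (((M - 1) ^ n : ℕ) : ℝ) := by exact_mod_cast this
    _ = _ := by rw [Nat.cast_pow, Nat.cast_sub (by omega)]; simp

end HausdorffDimension

section MiddleDigits

/-- The real with base `K + 2` digits `a i + 1`, so that the digits `0` and `K + 1` are avoided. -/
noncomputable def middleDigits {K : ℕ} (a : ℕ → Fin K) : ℝ :=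
  Real.ofDigits (fun i => (a i).succ.castSucc)

variable {K : ℕ} (a b : ℕ → Fin K)

lemma middleDigits_eq_head_add_tail :
    middleDigits a = ((a 0 : ℝ) + 1) / (K + 2) + middleDigits (fun i => a (i + 1)) / (K + 2) := by
  rw [middleDigits, Real.ofDigits_eq_sum_add_ofDigits _ 1]
  simp [Real.ofDigitsTerm, middleDigits]
  ring

lemma exists_middleDigits_eq_add_tail (n : ℕ) :
    ∃ z : ℤ, ((K : ℝ) + 2) ^ n * middleDigits a = z + middleDigits (fun i => a (i + n)) := by
  induction n with
  | zero => exact ⟨0, by simp⟩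
  | succ n ih =>
    obtain ⟨z, hz⟩ := ih
    refine ⟨(K + 2) * z + (a n + 1), ?_⟩
    have h := middleDigits_eq_head_add_tail (fun i => a (i + n))
    have hK : (K : ℝ) + 2 ≠ 0 := by positivity
    rw [pow_succ', mul_assoc, hz, h]
    push_cast
    field_simp
    simp only [zero_add, add_assoc, add_comm 1 n]

lemma middleDigits_mem_Icc :
    middleDigits a ∈ Icc ((K : ℝ) + 2)⁻¹ (1 - ((K : ℝ) + 2)⁻¹) := by
  have hK : (0 : ℝ) < (K : ℝ) + 2 := by positivity
  have h0 : 0 ≤ middleDigits (fun i => a (i + 1)) := Real.ofDigits_nonneg _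
  have h1 : middleDigits (fun i => a (i + 1)) ≤ 1 := Real.ofDigits_le_one _
  have ha : (a 0 : ℝ) + 1 ≤ K := by exact_mod_cast (a 0).isLt
  have ha0 : (0 : ℝ) ≤ a 0 := by positivity
  rw [middleDigits_eq_head_add_tail, ← add_div]
  constructor
  · rw [inv_eq_one_div]
    gcongr
    linarith
  · rw [div_le_iff₀ hK, sub_mul, inv_mul_cancel₀ hK.ne']
    linarith

lemma inv_le_abs_pow_mul_middleDigits_sub (n : ℕ) (z : ℤ) :
    ((K : ℝ) + 2)⁻¹ ≤ |((K : ℝ) + 2) ^ n * middleDigits a - z| := by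
  obtain ⟨w, hw⟩ := exists_middleDigits_eq_add_tail a n
  obtain ⟨h0, h1⟩ := middleDigits_mem_Icc (fun i => a (i + n))
  rw [hw, le_abs]
  rcases le_or_gt z w with h | h
  · left
    have : (z : ℝ) ≤ w := by exact_mod_cast h
    linarith
  · right
    have : (w : ℝ) + 1 ≤ z := by exact_mod_cast h
    linarith

lemma inv_sq_le_abs_sub_of_head_ne (h : a 0 ≠ b 0) :
    (((K : ℝ) + 2) ^ 2)⁻¹ ≤ |middleDigits a - middleDigits b| := by
  wlog hlt : b 0 < a 0 generalizing a b
  · rw [abs_sub_comm]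
    exact this b a h.symm (lt_of_le_of_ne (not_lt.1 hlt) h)
  have hK : (0 : ℝ) < (K : ℝ) + 2 := by positivity
  have hab : (b 0 : ℝ) + 1 ≤ a 0 := by exact_mod_cast hlt
  have ha := (middleDigits_mem_Icc (fun i => a (i + 1))).1
  have hb := (middleDigits_mem_Icc (fun i => b (i + 1))).2
  have hp : 0 < ((K : ℝ) + 2)⁻¹ := by positivity
  refine le_trans ?_ (le_abs_self _)
  rw [middleDigits_eq_head_add_tail a, middleDigits_eq_head_add_tail b, ← add_div, ← add_div,
    ← sub_div, le_div_iff₀ hK, pow_two, mul_inv, mul_assoc, inv_mul_cancel₀ hK.ne']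
  linarith

lemma inv_pow_le_abs_sub_of_first_ne {n : ℕ} (heq : ∀ i < n, a i = b i) (hne : a n ≠ b n) :
    (((K : ℝ) + 2) ^ (n + 2))⁻¹ ≤ |middleDigits a - middleDigits b| := by
  have h := inv_sq_le_abs_sub_of_head_ne (fun i => a (i + n)) (fun i => b (i + n)) (by simpa)
  have hsum : ∑ i ∈ Finset.range n, Real.ofDigitsTerm (fun i => (a i).succ.castSucc) i =
      ∑ i ∈ Finset.range n, Real.ofDigitsTerm (fun i => (b i).succ.castSucc) i :=
    Finset.sum_congr rfl fun i hi => by simp [Real.ofDigitsTerm, heq i (Finset.mem_range.1 hi)]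
  have hcast : ((K + 1 + 1 : ℕ) : ℝ) = (K : ℝ) + 2 := by push_cast; ring
  rw [middleDigits, middleDigits, Real.ofDigits_eq_sum_add_ofDigits _ n, hsum,
    Real.ofDigits_eq_sum_add_ofDigits (fun i => (b i).succ.castSucc) n, add_sub_add_left_eq_sub,
    ← mul_sub, abs_mul, abs_of_nonneg (by positivity), pow_add, mul_inv, hcast]
  exact mul_le_mul_of_nonneg_left h (by positivity)

/-- Comparison of base `K` expansions with shifted base `K + 2` expansions. -/
lemma abs_ofDigits_sub_le_abs_middleDigits_sub_rpow {r : ℝ} (hr : 0 < r)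
    (hKr : ((K : ℝ) + 2) ^ r ≤ K) :
    |Real.ofDigits a - Real.ofDigits b| ≤
      (((K : ℝ) + 2) ^ 2) ^ r * |middleDigits a - middleDigits b| ^ r := by
  by_cases hab : a = b
  · simp [hab, hr.ne']
  have hex : ∃ n, a n ≠ b n := Function.ne_iff.1 hab
  classical
  set n := Nat.find hex
  have hne : a n ≠ b n := Nat.find_spec hex
  have heq : ∀ i < n, a i = b i := fun i hi => not_not.1 (Nat.find_min hex hi)
  have hK : (0 : ℝ) < (K : ℝ) + 2 := by positivity
  refine (Real.abs_ofDigits_sub_ofDigits_le heq).trans ?_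
  rw [← Real.mul_rpow (by positivity) (abs_nonneg _)]
  calc ((K : ℝ) ^ n)⁻¹ ≤ ((((K : ℝ) + 2) ^ r) ^ n)⁻¹ := by gcongr
    _ = ((((K : ℝ) + 2) ^ n)⁻¹) ^ r := by
      rw [Real.inv_rpow (by positivity), ← Real.rpow_natCast, ← Real.rpow_natCast,
        ← Real.rpow_mul hK.le, ← Real.rpow_mul hK.le, mul_comm]
    _ ≤ _ := by
      refine Real.rpow_le_rpow (by positivity) ?_ hr.le
      have h := mul_le_mul_of_nonneg_left (inv_pow_le_abs_sub_of_first_ne a b heq hne)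
        (by positivity : (0 : ℝ) ≤ ((K : ℝ) + 2) ^ 2)
      refine le_trans (le_of_eq ?_) h
      field_simp
      ring

lemma le_dimH_range_middleDigits_div (hK : 1 < K) {r c : ℝ} (hr : 0 < r) (hc : 0 < c)
    (hKr : ((K : ℝ) + 2) ^ r ≤ K) :
    ENNReal.ofReal r ≤ dimH (range fun a : ℕ → Fin K => middleDigits a / c) := by
  have : Nonempty (ℕ → Fin K) := ⟨fun _ => ⟨0, by omega⟩⟩
  lift r to ℝ≥0 using hr.le
  have hr' : 0 < r := by exact_mod_cast hr
  have h := le_dimH_range_of_edist_le (C := Real.toNNReal ((((K : ℝ) + 2) ^ 2 * c) ^ (r : ℝ))) hr'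
    (φ := fun a : ℕ → Fin K => middleDigits a / c) (ψ := Real.ofDigits) fun a b => by
      rw [edist_dist, edist_dist, ENNReal.ofReal_rpow_of_nonneg dist_nonneg hr.le]
      change _ ≤ ENNReal.ofReal _ * _
      rw [← ENNReal.ofReal_mul (by positivity)]
      refine ENNReal.ofReal_le_ofReal ?_
      rw [Real.dist_eq, Real.dist_eq, ← Real.mul_rpow (by positivity) (abs_nonneg _), ← sub_div,
        abs_div, abs_of_pos hc, mul_assoc, mul_div_cancel₀ _ hc.ne',
        Real.mul_rpow (by positivity) (abs_nonneg _)]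
      exact abs_ofDigits_sub_le_abs_middleDigits_sub_rpow a b hr hKr
  have hIcc : Icc (0 : ℝ) 1 ⊆ range (Real.ofDigits (b := K)) := by
    simpa [SurjOn] using Real.ofDigits_SurjOn hK
  have h1 : (1 : ℝ≥0∞) ≤ dimH (range (Real.ofDigits (b := K))) := by
    refine le_trans (le_of_eq ?_) (dimH_mono hIcc)
    rw [Real.dimH_of_nonempty_interior (by simp)]
    simp
  have h2 := h1.trans h
  rw [ENNReal.le_div_iff_mul_le (Or.inl (by exact_mod_cast hr'.ne')) (Or.inl ENNReal.coe_ne_top),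
    one_mul] at h2
  simpa using h2

lemma middleDigits_div_mem_Eset {s m : ℕ} (hs : 2 ≤ s) (hm : s ^ m = K + 2) :
    middleDigits a / ((K : ℝ) + 2) ^ 2 ∈ Eset s := by
  have hs' : (2 : ℝ) ≤ s := by exact_mod_cast hs
  have hs0 : (0 : ℝ) < s := by linarith
  have hm' : (s : ℝ) ^ m = (K : ℝ) + 2 := by exact_mod_cast hm
  have hm0 : m ≠ 0 := by rintro rfl; simp at hm
  set y := middleDigits a with hy
  have hy0 : 0 ≤ y := Real.ofDigits_nonneg _
  have hy1 : y ≤ 1 := Real.ofDigits_le_one _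
  rw [← hm', ← pow_mul]
  have hP : (0 : ℝ) < (s : ℝ) ^ (m * 2) := by positivity
  have hP2 : (2 : ℝ) ≤ (s : ℝ) ^ (m * 2) :=
    hs'.trans (le_self_pow₀ (by linarith) (by omega))
  have hle : y / (s : ℝ) ^ (m * 2) ≤ ((s : ℝ) ^ (m * 2))⁻¹ := by
    rw [inv_eq_one_div]; gcongr
  have hhalf : ((s : ℝ) ^ (m * 2))⁻¹ ≤ 1 / 2 := by
    rw [inv_eq_one_div]; gcongr
  refine mem_Eset_of_le_abs_sub (by positivity) (by linarith) fun k hk n => ?_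
  rcases lt_or_ge k (m * 2) with hkm | hkm
  · have h1 : y / (s : ℝ) ^ (m * 2) ≤ (s : ℝ) ^ k * (y / (s : ℝ) ^ (m * 2)) :=
      le_mul_of_one_le_left (by positivity) (one_le_pow₀ (by linarith))
    have h2 : (s : ℝ) ^ k * (y / (s : ℝ) ^ (m * 2)) ≤ 1 / 2 := by
      rw [← mul_div_assoc, div_le_iff₀ hP]
      have : (s : ℝ) ^ (k + 1) ≤ (s : ℝ) ^ (m * 2) :=
        pow_le_pow_right₀ (by linarith) hkm
      rw [pow_succ] at this
      have hk0 : (0 : ℝ) < (s : ℝ) ^ k := by positivity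
      nlinarith
    rw [le_abs]
    rcases le_or_gt n 0 with hn | hn
    · left
      have : (n : ℝ) ≤ 0 := by exact_mod_cast hn
      linarith
    · right
      have : (1 : ℝ) ≤ n := by exact_mod_cast hn
      linarith
  · obtain ⟨l, rfl⟩ := Nat.exists_eq_add_of_le hkm
    refine hle.trans ?_
    rw [pow_add, mul_comm ((s : ℝ) ^ (m * 2)), mul_assoc, mul_div_cancel₀ _ hP.ne']
    obtain ⟨j, hj, hlj⟩ : ∃ j ≤ m, l + j = m * (l / m + 1) :=
      ⟨m - l % m, Nat.sub_le _ _, by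
        have := Nat.div_add_mod l m
        have := Nat.mod_lt l (Nat.pos_of_ne_zero hm0)
        rw [mul_add, mul_one]
        omega⟩
    have h := inv_le_abs_pow_mul_middleDigits_sub a (l / m + 1) (s ^ j * n)
    rw [← hm', ← pow_mul, ← hlj, ← hy] at h
    have hfac : (s : ℝ) ^ (l + j) * y - ((s ^ j * n : ℤ) : ℝ) =
        (s : ℝ) ^ j * ((s : ℝ) ^ l * y - n) := by
      push_cast
      ring
    rw [hfac, abs_mul, abs_of_nonneg (by positivity)] at h
    have h3 := h.trans (mul_le_mul_of_nonneg_right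
      (pow_le_pow_right₀ (by linarith : (1 : ℝ) ≤ s) hj) (abs_nonneg _))
    rw [pow_mul, pow_two, mul_inv, ← div_eq_mul_inv, div_le_iff₀ (by positivity), mul_comm]
    exact h3

end MiddleDigits

lemma ofReal_le_dimH_Eset {s : ℕ} (hs : 2 ≤ s) {r : ℝ} (hr₀ : 0 < r) (hr₁ : r < 1) :
    ENNReal.ofReal r ≤ dimH (Eset s) := by
  have hs' : (1 : ℝ) < s := by exact_mod_cast hs
  have hpow : Tendsto (fun m : ℕ => (s : ℝ) ^ m) atTop atTop :=
    tendsto_pow_atTop_atTop_of_one_lt hs'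
  obtain ⟨m, hm4, hm2⟩ := ((hpow.eventually_ge_atTop 4).and
    (((tendsto_rpow_atTop (sub_pos.2 hr₁)).comp hpow).eventually_ge_atTop 2)).exists
  have hm4' : 4 ≤ s ^ m := by exact_mod_cast hm4
  obtain ⟨K, hK⟩ := Nat.exists_eq_add_of_le' (show 2 ≤ s ^ m by omega)
  have hKR : (s : ℝ) ^ m = (K : ℝ) + 2 := by exact_mod_cast hK
  simp only [Function.comp, hKR] at hm2 hm4
  refine (le_dimH_range_middleDigits_div (K := K) (c := ((K : ℝ) + 2) ^ 2) (by omega) hr₀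
    (by positivity) ?_).trans (dimH_mono ?_)
  · have hpos : (0 : ℝ) < (K : ℝ) + 2 := by positivity
    have hmul : ((K : ℝ) + 2) ^ r * ((K : ℝ) + 2) ^ (1 - r) = (K : ℝ) + 2 := by
      rw [← Real.rpow_add hpos]
      simp
    have := mul_le_mul_of_nonneg_left hm2 (Real.rpow_nonneg hpos.le r)
    linarith
  · rintro _ ⟨a, rfl⟩
    exact middleDigits_div_mem_Eset a hs hK

lemma dimH_Eset_diff_Ico_lt_one {s : ℕ} (hs : 2 ≤ s) {δ : ℝ} (hδ : 0 < δ) :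
    dimH (Eset s \ Ico 0 δ) < 1 := by
  have hs' : (1 : ℝ) < s := by exact_mod_cast hs
  obtain ⟨m, hmδ, hm2⟩ := (((tendsto_pow_atTop_atTop_of_one_lt hs').eventually_ge_atTop
    δ⁻¹).and (eventually_ge_atTop 1)).exists
  have hMge : s ^ m ≤ s ^ (2 * m) := Nat.pow_le_pow_right (by omega) (by omega)
  have hM : 2 ≤ s ^ (2 * m) :=
    (hs.trans (Nat.le_self_pow (by omega) s)).trans hMge
  have hMδ : (((s ^ (2 * m) : ℕ) : ℝ))⁻¹ ≤ δ := by
    rw [inv_le_comm₀ (by positivity) hδ]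
    exact hmδ.trans (by exact_mod_cast hMge)
  refine dimH_lt_one_of_inv_le_fract hM fun x hx => ?_
  obtain ⟨⟨⟨hx0, hx1⟩, hk⟩, hnot⟩ := hx
  have hxδ : δ ≤ x := not_lt.1 fun h => hnot ⟨hx0, h⟩
  have hxne : x ≠ 1 := by
    rintro rfl
    have := hk 1 le_rfl
    norm_num [gmap] at this
  have hxlt : x < 1 := lt_of_le_of_ne hx1 hxne
  refine ⟨⟨hx0, hxlt⟩, fun k => hMδ.trans (hxδ.trans ?_)⟩
  rcases Nat.eq_zero_or_pos k with rfl | hk0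
  · simp [Int.fract_eq_self.2 ⟨hx0, hxlt⟩]
  · have := hk (2 * m * k) (Nat.mul_pos (by omega) hk0)
    rw [gmap_iterate s x (Nat.mul_pos (by omega) hk0), mul_assoc 2, pow_mul, neg_sq, ← pow_mul,
      ← mul_assoc, pow_mul] at this
    exact_mod_cast this

/-- for integer slope `s ≥ 2` the bifurcation set `E` has Hausdorff dimension
`1`, while `E \ [0, δ)` has Hausdorff dimension strictly less than `1` for every `δ > 0`. -/
theorem bifurcation_set_dimension (s : ℕ) (hs : 2 ≤ s) :
    dimH (Eset s) = 1 ∧ ∀ δ : ℝ, 0 < δ → dimH (Eset s \ Set.Ico 0 δ) < 1 := by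
  refine ⟨le_antisymm ((dimH_mono (subset_univ _)).trans Real.dimH_univ.le) ?_,
    fun δ hδ => dimH_Eset_diff_Ico_lt_one hs hδ⟩
  refine le_of_forall_lt fun c hc => ?_
  obtain ⟨r, hcr, hr1⟩ := exists_between hc
  have hr_top : r ≠ ∞ := (hr1.trans ENNReal.one_lt_top).ne
  refine hcr.trans_le ?_
  rw [← ENNReal.ofReal_toReal hr_top]
  refine ofReal_le_dimH_Eset hs (ENNReal.toReal_pos (pos_of_gt hcr).ne' hr_top) ?_
  simpa using (ENNReal.toReal_lt_toReal hr_top ENNReal.one_ne_top).2 hr1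
end
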